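/- arXiv:2407.02663 — 7 statements merged into one kernel-verified Lean document; each statement's English description precedes it below -/
import Mathlib

section
/- Let X = ⊔_{λ∈Λ} G_λ be a multiple conjugation quandle and k a commutative ring. Let k[X] be the free k-module on X, let μ : k[X]⊗k[X] → k[X] be the linear map with μ(x⊗y) = xy (the product in G_λ) when x,y lie in a common component G_λ and μ(x⊗y) = 0 otherwise, and let R : k[X]⊗k[X] → k[X]⊗k[X] be the linear map with R(x⊗y) = y⊗(x*y) on generators. Then μ is associative, R satisfies the Yang–Baxter equation (R⊗1)(1⊗R)(R⊗1) = (1⊗R)(R⊗1)(1⊗R), the YI condition (1⊗μ)(R⊗1)(1⊗R) = R(μ⊗1) and the IY condition (μ⊗1)(1⊗R)(R⊗1) = R(1⊗μ) hold, and braided commutativity μR = μ holds. -/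
open TensorProduct LinearMap

noncomputable section

variable {k : Type*} [CommRing k] {V : Type*} [AddCommGroup V] [Module k V]

/-- `g ⊗ 1` acting on `(V ⊗ V) ⊗ V`, for `g : V ⊗ V → V ⊗ V`. -/
def rT2 (g : V ⊗[k] V →ₗ[k] V ⊗[k] V) :
    (V ⊗[k] V) ⊗[k] V →ₗ[k] (V ⊗[k] V) ⊗[k] V :=
  g.rTensor V

/-- `1 ⊗ g` acting on `(V ⊗ V) ⊗ V`, for `g : V ⊗ V → V ⊗ V`. -/
def lT2 (g : V ⊗[k] V →ₗ[k] V ⊗[k] V) :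
    (V ⊗[k] V) ⊗[k] V →ₗ[k] (V ⊗[k] V) ⊗[k] V :=
  (TensorProduct.assoc k V V V).symm.toLinearMap ∘ₗ g.lTensor V ∘ₗ
    (TensorProduct.assoc k V V V).toLinearMap

/-- `h ⊗ 1 : V ⊗ V ⊗ V → V ⊗ V`, for `h : V ⊗ V → V`. -/
def rT21 (h : V ⊗[k] V →ₗ[k] V) :
    (V ⊗[k] V) ⊗[k] V →ₗ[k] V ⊗[k] V :=
  h.rTensor V

/-- `1 ⊗ h : V ⊗ V ⊗ V → V ⊗ V`, for `h : V ⊗ V → V`. -/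
def lT21 (h : V ⊗[k] V →ₗ[k] V) :
    (V ⊗[k] V) ⊗[k] V →ₗ[k] V ⊗[k] V :=
  h.lTensor V ∘ₗ (TensorProduct.assoc k V V V).toLinearMap

/-- first Hochschild differential -/
def d1H (μ : V ⊗[k] V →ₗ[k] V) (f : V →ₗ[k] V) : V ⊗[k] V →ₗ[k] V :=
  μ ∘ₗ f.rTensor V + μ ∘ₗ f.lTensor V - f ∘ₗ μ

/-- first Yang-Baxter differential -/
def d1YB (R : V ⊗[k] V →ₗ[k] V ⊗[k] V) (f : V →ₗ[k] V) :
    V ⊗[k] V →ₗ[k] V ⊗[k] V :=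
  R ∘ₗ f.rTensor V + R ∘ₗ f.lTensor V - f.rTensor V ∘ₗ R - f.lTensor V ∘ₗ R

/-- second Hochschild differential -/
def d2H (μ : V ⊗[k] V →ₗ[k] V) (ψ : V ⊗[k] V →ₗ[k] V) :
    (V ⊗[k] V) ⊗[k] V →ₗ[k] V :=
  μ ∘ₗ rT21 ψ + ψ ∘ₗ rT21 μ - μ ∘ₗ lT21 ψ - ψ ∘ₗ lT21 μ

/-- second Yang-Baxter differential -/
def d2YB (R φ : V ⊗[k] V →ₗ[k] V ⊗[k] V) :
    (V ⊗[k] V) ⊗[k] V →ₗ[k] (V ⊗[k] V) ⊗[k] V :=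
  rT2 R ∘ₗ lT2 R ∘ₗ rT2 φ + rT2 R ∘ₗ lT2 φ ∘ₗ rT2 R + rT2 φ ∘ₗ lT2 R ∘ₗ rT2 R
    - lT2 R ∘ₗ rT2 R ∘ₗ lT2 φ - lT2 R ∘ₗ rT2 φ ∘ₗ lT2 R - lT2 φ ∘ₗ rT2 R ∘ₗ lT2 R

/-- YI component of the second Yang-Baxter Hochschild differential -/
def d2YI (μ : V ⊗[k] V →ₗ[k] V) (R φ : V ⊗[k] V →ₗ[k] V ⊗[k] V)
    (ψ : V ⊗[k] V →ₗ[k] V) : (V ⊗[k] V) ⊗[k] V →ₗ[k] V ⊗[k] V :=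
  lT21 ψ ∘ₗ rT2 R ∘ₗ lT2 R + lT21 μ ∘ₗ rT2 φ ∘ₗ lT2 R + lT21 μ ∘ₗ rT2 R ∘ₗ lT2 φ
    - R ∘ₗ rT21 ψ - φ ∘ₗ rT21 μ

/-- IY component of the second Yang-Baxter Hochschild differential -/
def d2IY (μ : V ⊗[k] V →ₗ[k] V) (R φ : V ⊗[k] V →ₗ[k] V ⊗[k] V)
    (ψ : V ⊗[k] V →ₗ[k] V) : (V ⊗[k] V) ⊗[k] V →ₗ[k] V ⊗[k] V :=
  rT21 ψ ∘ₗ lT2 R ∘ₗ rT2 R + rT21 μ ∘ₗ lT2 φ ∘ₗ rT2 R + rT21 μ ∘ₗ lT2 R ∘ₗ rT2 φ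
    - R ∘ₗ lT21 ψ - φ ∘ₗ lT21 μ

/-- `(V,μ,R)` is a braided algebra. -/
structure IsBraidedAlgebra (μ : V ⊗[k] V →ₗ[k] V)
    (R : V ⊗[k] V →ₗ[k] V ⊗[k] V) : Prop where
  assoc : μ ∘ₗ rT21 μ = μ ∘ₗ lT21 μ
  Rbij : Function.Bijective R
  yb : rT2 R ∘ₗ lT2 R ∘ₗ rT2 R = lT2 R ∘ₗ rT2 R ∘ₗ lT2 R
  yi : lT21 μ ∘ₗ rT2 R ∘ₗ lT2 R = R ∘ₗ rT21 μ
  iy : rT21 μ ∘ₗ lT2 R ∘ₗ rT2 R = R ∘ₗ lT21 μ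

section MCQ

variable {Λ : Type*} {G : Λ → Type*} [∀ l, Group (G l)]

/-- A multiple conjugation quandle structure on the disjoint union
`X = ⊔_{λ ∈ Λ} G_λ`. -/
structure IsMCQ (op : (Σ l, G l) → (Σ l, G l) → (Σ l, G l)) : Prop where
  /-- On each component the operation is conjugation: `a * b = b⁻¹ a b`. -/
  conj : ∀ (l : Λ) (a b : G l), op ⟨l, a⟩ ⟨l, b⟩ = ⟨l, b⁻¹ * a * b⟩
  /-- `x * e_λ = x`. -/
  op_one : ∀ (x : Σ l, G l) (l : Λ), op x ⟨l, 1⟩ = x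
  /-- `x * (ab) = (x * a) * b`. -/
  op_mul : ∀ (x : Σ l, G l) (l : Λ) (a b : G l),
    op x ⟨l, a * b⟩ = op (op x ⟨l, a⟩) ⟨l, b⟩
  /-- Self-distributivity: `(x*y)*z = (x*z)*(y*z)`. -/
  distrib : ∀ x y z, op (op x y) z = op (op x z) (op y z)
  /-- `(ab) * x = (a*x)(b*x)` in some component `G_m`. -/
  mul_op : ∀ (l : Λ) (a b : G l) (x : Σ l', G l'), ∃ (m : Λ) (c d : G m),
    op ⟨l, a⟩ x = ⟨m, c⟩ ∧ op ⟨l, b⟩ x = ⟨m, d⟩ ∧ op ⟨l, a * b⟩ x = ⟨m, c * d⟩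

variable (k : Type*) [CommRing k]

open scoped Classical in
/-- The product of two generators of `k[X]`: their group product if they lie
in a common component, and `0` otherwise. -/
def mcqProd (x y : Σ l, G l) : (Σ l, G l) →₀ k :=
  if h : x.1 = y.1 then
    Finsupp.single ⟨x.1, x.2 * cast (congrArg G h).symm y.2⟩ (1 : k)
  else 0

/-- The multiplication `μ : k[X] ⊗ k[X] → k[X]` of the braided algebra
associated to an MCQ. -/
def mcqMul :
    ((Σ l, G l) →₀ k) ⊗[k] ((Σ l, G l) →₀ k) →ₗ[k] ((Σ l, G l) →₀ k) :=
  TensorProduct.lift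
    (Finsupp.lift (((Σ l, G l) →₀ k) →ₗ[k] ((Σ l, G l) →₀ k)) k (Σ l, G l)
      (fun x => Finsupp.lift ((Σ l, G l) →₀ k) k (Σ l, G l)
        (fun y => mcqProd k x y)))

/-- The braiding `R : k[X] ⊗ k[X] → k[X] ⊗ k[X]`, with
`R(x ⊗ y) = y ⊗ (x * y)` on generators. -/
def mcqR (op : (Σ l, G l) → (Σ l, G l) → (Σ l, G l)) :
    ((Σ l, G l) →₀ k) ⊗[k] ((Σ l, G l) →₀ k) →ₗ[k]
      ((Σ l, G l) →₀ k) ⊗[k] ((Σ l, G l) →₀ k) :=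
  TensorProduct.lift
    (Finsupp.lift
      (((Σ l, G l) →₀ k) →ₗ[k]
        ((Σ l, G l) →₀ k) ⊗[k] ((Σ l, G l) →₀ k)) k (Σ l, G l)
      (fun x => Finsupp.lift
        (((Σ l, G l) →₀ k) ⊗[k] ((Σ l, G l) →₀ k)) k (Σ l, G l)
        (fun y => (Finsupp.single y (1 : k)) ⊗ₜ[k]
          (Finsupp.single (op x y) (1 : k)))))

section PureTensors

variable {k W : Type*} [CommRing k] [AddCommGroup W] [Module k W]

@[simp]
lemma rT2_tmul (g : W ⊗[k] W →ₗ[k] W ⊗[k] W) (t : W ⊗[k] W) (z : W) :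
    rT2 g (t ⊗ₜ z) = g t ⊗ₜ z := rfl

@[simp]
lemma lT2_tmul (g : W ⊗[k] W →ₗ[k] W ⊗[k] W) (x y z : W) :
    lT2 g (x ⊗ₜ y ⊗ₜ z) = (TensorProduct.assoc k W W W).symm (x ⊗ₜ g (y ⊗ₜ z)) := rfl

@[simp]
lemma rT21_tmul (h : W ⊗[k] W →ₗ[k] W) (t : W ⊗[k] W) (z : W) :
    rT21 h (t ⊗ₜ z) = h t ⊗ₜ z := rfl

@[simp]
lemma lT21_tmul (h : W ⊗[k] W →ₗ[k] W) (x y z : W) :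
    lT21 h (x ⊗ₜ y ⊗ₜ z) = x ⊗ₜ h (y ⊗ₜ z) := rfl

end PureTensors

@[simp]
lemma mcqMul_single (x y : Σ l, G l) :
    mcqMul k (Finsupp.single x 1 ⊗ₜ Finsupp.single y 1) = mcqProd k x y := by
  simp [mcqMul]

@[simp]
lemma mcqR_single {M : Λ → Type*} (op : (Σ l, M l) → (Σ l, M l) → (Σ l, M l))
    (x y : Σ l, M l) :
    mcqR k op (Finsupp.single x 1 ⊗ₜ Finsupp.single y 1) =
      Finsupp.single y 1 ⊗ₜ Finsupp.single (op x y) 1 := by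
  simp [mcqR]

@[simp]
lemma mcqProd_mk (l : Λ) (a b : G l) :
    mcqProd k ⟨l, a⟩ ⟨l, b⟩ = Finsupp.single ⟨l, a * b⟩ (1 : k) := by
  simp [mcqProd]

lemma mcqProd_of_ne {x y : Σ l, G l} (h : x.1 ≠ y.1) : mcqProd k x y = 0 := by
  simp [mcqProd, h]

/-- Right translation by `z` is undone by right translation by `z⁻¹`. -/
lemma IsMCQ.op_op_inv {op : (Σ l, G l) → (Σ l, G l) → (Σ l, G l)} (h : IsMCQ op)
    (x z : Σ l, G l) : op (op x z) ⟨z.1, z.2⁻¹⟩ = x := by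
  obtain ⟨l, c⟩ := z
  rw [← h.op_mul, mul_inv_cancel, h.op_one]

lemma IsMCQ.op_fst_eq {op : (Σ l, G l) → (Σ l, G l) → (Σ l, G l)} (h : IsMCQ op)
    {x y : Σ l, G l} (hxy : x.1 = y.1) (z : Σ l, G l) : (op x z).1 = (op y z).1 := by
  obtain ⟨l, a⟩ := x
  obtain ⟨m, b⟩ := y
  obtain rfl : l = m := hxy
  obtain ⟨n, c, d, hc, hd, -⟩ := h.mul_op l a b z
  rw [hc, hd]

/-- Right translations permute the components. -/
lemma IsMCQ.op_fst_eq_iff {op : (Σ l, G l) → (Σ l, G l) → (Σ l, G l)} (h : IsMCQ op)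
    (x y z : Σ l, G l) : (op x z).1 = (op y z).1 ↔ x.1 = y.1 := by
  refine ⟨fun hxy => ?_, fun hxy => h.op_fst_eq hxy z⟩
  simpa only [h.op_op_inv] using h.op_fst_eq hxy ⟨z.1, z.2⁻¹⟩

lemma IsMCQ.op_self {op : (Σ l, G l) → (Σ l, G l) → (Σ l, G l)} (h : IsMCQ op)
    (x : Σ l, G l) : op x x = x := by
  obtain ⟨l, a⟩ := x
  simp [h.conj]

lemma mcq_assoc_single (x y z : Σ l, G l) :
    mcqMul k (mcqProd k x y ⊗ₜ Finsupp.single z 1) =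
      mcqMul k (Finsupp.single x 1 ⊗ₜ mcqProd k y z) := by
  obtain ⟨l, a⟩ := x
  obtain ⟨m, b⟩ := y
  obtain ⟨n, c⟩ := z
  by_cases hlm : l = m <;> by_cases hmn : m = n
  · subst hlm hmn
    simp [mul_assoc]
  · subst hlm
    simp [mcqProd_of_ne, hmn]
  · subst hmn
    simp [mcqProd_of_ne, hlm]
  · simp [mcqProd_of_ne, hlm, hmn]

lemma IsMCQ.yi_single {op : (Σ l, G l) → (Σ l, G l) → (Σ l, G l)} (h : IsMCQ op)
    (x y z : Σ l, G l) :
    Finsupp.single z 1 ⊗ₜ mcqProd k (op x z) (op y z) =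
      mcqR k op (mcqProd k x y ⊗ₜ Finsupp.single z 1) := by
  by_cases hxy : x.1 = y.1
  · obtain ⟨l, a⟩ := x
    obtain ⟨m, b⟩ := y
    obtain rfl : l = m := hxy
    obtain ⟨n, c, d, hc, hd, hcd⟩ := h.mul_op l a b z
    simp [hc, hd, hcd]
  · rw [mcqProd_of_ne k hxy, mcqProd_of_ne k (mt (h.op_fst_eq_iff x y z).1 hxy)]
    simp

lemma IsMCQ.iy_single {op : (Σ l, G l) → (Σ l, G l) → (Σ l, G l)} (h : IsMCQ op)
    (x y z : Σ l, G l) :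
    mcqProd k y z ⊗ₜ Finsupp.single (op (op x y) z) 1 =
      mcqR k op (Finsupp.single x 1 ⊗ₜ mcqProd k y z) := by
  by_cases hyz : y.1 = z.1
  · obtain ⟨l, a⟩ := y
    obtain ⟨m, b⟩ := z
    obtain rfl : l = m := hyz
    simp [h.op_mul]
  · simp [mcqProd_of_ne k hyz]

lemma IsMCQ.mcqProd_op {op : (Σ l, G l) → (Σ l, G l) → (Σ l, G l)} (h : IsMCQ op)
    (x y : Σ l, G l) : mcqProd k y (op x y) = mcqProd k x y := by
  by_cases hxy : x.1 = y.1
  · obtain ⟨l, a⟩ := x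
    obtain ⟨m, b⟩ := y
    obtain rfl : l = m := hxy
    simp [h.conj, mul_assoc]
  · have hyx : y.1 ≠ (op x y).1 := fun e =>
      hxy ((h.op_fst_eq_iff x y y).1 (by rw [h.op_self, e]))
    rw [mcqProd_of_ne k hxy, mcqProd_of_ne k hyx]

/-- for a multiple conjugation quandle `X = ⊔_{λ∈Λ} G_λ` and a
commutative ring `k`, the free module `k[X]` with the multiplication `μ`
(`μ(x⊗y) = xy` on a common component, `0` otherwise) and the braiding
`R(x⊗y) = y ⊗ (x*y)` is an associative algebra whose braiding satisfies the
Yang-Baxter equation and the YI and IY conditions, and which is braided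
commutative: `μ ∘ R = μ`. -/
theorem mcq_braided_commutative_braided_algebra
    (op : (Σ l, G l) → (Σ l, G l) → (Σ l, G l)) (hMCQ : IsMCQ op) :
    (mcqMul (G := G) k ∘ₗ rT21 (mcqMul (G := G) k) =
      mcqMul (G := G) k ∘ₗ lT21 (mcqMul (G := G) k)) ∧
    (rT2 (mcqR k op) ∘ₗ lT2 (mcqR k op) ∘ₗ rT2 (mcqR k op) =
      lT2 (mcqR k op) ∘ₗ rT2 (mcqR k op) ∘ₗ lT2 (mcqR k op)) ∧
    (lT21 (mcqMul k) ∘ₗ rT2 (mcqR k op) ∘ₗ lT2 (mcqR k op) =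
      mcqR k op ∘ₗ rT21 (mcqMul k)) ∧
    (rT21 (mcqMul k) ∘ₗ lT2 (mcqR k op) ∘ₗ rT2 (mcqR k op) =
      mcqR k op ∘ₗ lT21 (mcqMul k)) ∧
    (mcqMul k ∘ₗ mcqR k op = mcqMul k) := by
  refine ⟨?_, ?_, ?_, ?_, ?_⟩
  · ext x y z : 8
    simp [mcq_assoc_single]
  · ext x y z : 8
    simp [← hMCQ.distrib x y z]
  · ext x y z : 8
    simp [hMCQ.yi_single k]
  · ext x y z : 8
    simp [hMCQ.iy_single k]
  · ext x y : 5
    simp [hMCQ.mcqProd_op k]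

end MCQ

end
end

section
/- Let k be a commutative ring, V a k-module, and R : V⊗V → V⊗V a linear map satisfying the Yang–Baxter equation (R⊗1)(1⊗R)(R⊗1) = (1⊗R)(R⊗1)(1⊗R). Then for every linear map f : V → V, δ²_YB(δ¹_YB(f)) = 0. -/
open TensorProduct LinearMap

noncomputable section

variable {k : Type*} [CommRing k] {V : Type*} [AddCommGroup V] [Module k V]

/-- The diagonal action of `f` on `(V ⊗ V) ⊗ V` as a derivation:
`f ⊗ 1 ⊗ 1 + 1 ⊗ f ⊗ 1 + 1 ⊗ 1 ⊗ f`. -/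
def diagT3 (f : V →ₗ[k] V) : Module.End k ((V ⊗[k] V) ⊗[k] V) :=
  (f.rTensor V + f.lTensor V).rTensor V + f.lTensor (V ⊗[k] V)

theorem diagT3_eq_conj_assoc (f : V →ₗ[k] V) :
    diagT3 f = (TensorProduct.assoc k V V V).symm.toLinearMap ∘ₗ
      (f.rTensor (V ⊗[k] V) + (f.rTensor V + f.lTensor V).lTensor V) ∘ₗ
        (TensorProduct.assoc k V V V).toLinearMap := by
  ext x y z
  simp [diagT3, add_assoc]

theorem d1YB_eq_commutator (R : V ⊗[k] V →ₗ[k] V ⊗[k] V) (f : V →ₗ[k] V) :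
    d1YB R f = R ∘ₗ (f.rTensor V + f.lTensor V) - (f.rTensor V + f.lTensor V) ∘ₗ R := by
  rw [d1YB, LinearMap.comp_add, LinearMap.add_comp]
  abel

theorem rT2_d1YB (R : V ⊗[k] V →ₗ[k] V ⊗[k] V) (f : V →ₗ[k] V) :
    rT2 (d1YB R f) = rT2 R ∘ₗ diagT3 f - diagT3 f ∘ₗ rT2 R := by
  have hcomm : R.rTensor V ∘ₗ f.lTensor (V ⊗[k] V) = f.lTensor (V ⊗[k] V) ∘ₗ R.rTensor V := by
    rw [LinearMap.rTensor_comp_lTensor, LinearMap.lTensor_comp_rTensor]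
  rw [d1YB_eq_commutator, diagT3, rT2, rT2, LinearMap.rTensor_sub, LinearMap.rTensor_comp,
    LinearMap.rTensor_comp, LinearMap.comp_add, LinearMap.add_comp, hcomm]
  abel

theorem lT2_d1YB (R : V ⊗[k] V →ₗ[k] V ⊗[k] V) (f : V →ₗ[k] V) :
    lT2 (d1YB R f) = lT2 R ∘ₗ diagT3 f - diagT3 f ∘ₗ lT2 R := by
  have hcomm : R.lTensor V ∘ₗ f.rTensor (V ⊗[k] V) = f.rTensor (V ⊗[k] V) ∘ₗ R.lTensor V := by
    rw [LinearMap.rTensor_comp_lTensor, LinearMap.lTensor_comp_rTensor]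
  have hlTensor : (d1YB R f).lTensor V =
      R.lTensor V ∘ₗ (f.rTensor (V ⊗[k] V) + (f.rTensor V + f.lTensor V).lTensor V) -
        (f.rTensor (V ⊗[k] V) + (f.rTensor V + f.lTensor V).lTensor V) ∘ₗ R.lTensor V := by
    rw [d1YB_eq_commutator, LinearMap.lTensor_sub, LinearMap.lTensor_comp,
      LinearMap.lTensor_comp, LinearMap.comp_add, LinearMap.add_comp, hcomm]
    abel
  rw [diagT3_eq_conj_assoc, lT2, lT2, hlTensor]
  refine LinearMap.ext fun x => ?_
  simp only [LinearMap.comp_apply, LinearMap.sub_apply, LinearEquiv.coe_coe, map_sub,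
    LinearEquiv.apply_symm_apply]

/-- The linearization of the braid relation vanishes on commutators with a fixed element. -/
theorem braid_commutator_sum_eq_zero {A : Type*} [Ring A] {a b : A}
    (h : a * (b * a) = b * (a * b)) (d : A) :
    a * (b * (a * d - d * a)) + a * ((b * d - d * b) * a) + (a * d - d * a) * (b * a)
      - b * (a * (b * d - d * b)) - b * ((a * d - d * a) * b) - (b * d - d * b) * (a * b)
      = 0 := by
  calc
    _ = (a * (b * a) - b * (a * b)) * d - d * (a * (b * a) - b * (a * b)) := by noncomm_ring
    _ = 0 := by rw [h, sub_self, zero_mul, mul_zero, sub_self]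

/-- if `R` satisfies the Yang-Baxter equation, then
`δ²_YB (δ¹_YB f) = 0` for every linear map `f : V → V`. -/
theorem d2YB_d1YB_eq_zero {k : Type*} [CommRing k] {V : Type*} [AddCommGroup V]
    [Module k V] (R : V ⊗[k] V →ₗ[k] V ⊗[k] V)
    (hYB : rT2 R ∘ₗ lT2 R ∘ₗ rT2 R = lT2 R ∘ₗ rT2 R ∘ₗ lT2 R)
    (f : V →ₗ[k] V) :
    d2YB R (d1YB R f) = 0 := by
  rw [d2YB, rT2_d1YB, lT2_d1YB]
  exact braid_commutator_sum_eq_zero (A := Module.End k ((V ⊗[k] V) ⊗[k] V)) hYB (diagT3 f)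

end
end

section
/- Let (V, μ, R) be a braided commutative braided algebra over a commutative ring k, and let ψ : V⊗V → V and φ : V⊗V → V⊗V be linear maps. Extend μ, R, ψ, φ linearly to Ṽ = V ⊗_k (k[ℏ]/(ℏ²)) and set μ̃ = μ + ℏψ and R̃ = R + ℏφ. Then μ̃ is associative, R̃ satisfies the Yang–Baxter equation, (μ̃, R̃) satisfies the YI and IY conditions, and μ̃R̃ = μ̃ (i.e., (Ṽ, μ̃, R̃) is a braided commutative infinitesimal deformation of (V, μ, R)) if and only if δ²_YB(φ) = 0, δ²_YI(φ,ψ) = 0, δ²_IY(φ,ψ) = 0, δ²_H(ψ) = 0, and μφ + ψR − ψ = 0, i.e., (φ,ψ) is a braided commutative 2-cocycle. -/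
open TensorProduct LinearMap

noncomputable section

variable {k : Type*} [CommRing k] {V : Type*} [AddCommGroup V] [Module k V]

set_option synthInstance.maxHeartbeats 1000000
set_option maxHeartbeats 1000000

/-- The canonical `k[ℏ]/(ℏ²)`-linear identification
`Ṽ ⊗_{k[ℏ]/(ℏ²)} Ṽ ≅ (k[ℏ]/(ℏ²)) ⊗_k (V ⊗_k V)`, where
`Ṽ = (k[ℏ]/(ℏ²)) ⊗_k V` and `k[ℏ]/(ℏ²)` is realised as `DualNumber k`. -/
def defEquiv {k : Type*} [CommRing k] {V : Type*} [AddCommGroup V] [Module k V] :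
    (DualNumber k ⊗[k] V) ⊗[DualNumber k] (DualNumber k ⊗[k] V) ≃ₗ[DualNumber k]
      DualNumber k ⊗[k] (V ⊗[k] V) :=
  (TensorProduct.AlgebraTensorModule.distribBaseChange k (DualNumber k) V V).symm

/-- Linear extension of a map `V ⊗ V → V` to `Ṽ ⊗ Ṽ → Ṽ`. -/
def ext21 {k : Type*} [CommRing k] {V : Type*} [AddCommGroup V] [Module k V]
    (f : V ⊗[k] V →ₗ[k] V) :
    (DualNumber k ⊗[k] V) ⊗[DualNumber k] (DualNumber k ⊗[k] V) →ₗ[DualNumber k]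
      DualNumber k ⊗[k] V :=
  f.baseChange (DualNumber k) ∘ₗ defEquiv.toLinearMap

/-- Linear extension of a map `V ⊗ V → V ⊗ V` to `Ṽ ⊗ Ṽ → Ṽ ⊗ Ṽ`. -/
def ext22 {k : Type*} [CommRing k] {V : Type*} [AddCommGroup V] [Module k V]
    (f : V ⊗[k] V →ₗ[k] V ⊗[k] V) :
    (DualNumber k ⊗[k] V) ⊗[DualNumber k] (DualNumber k ⊗[k] V) →ₗ[DualNumber k]
      (DualNumber k ⊗[k] V) ⊗[DualNumber k] (DualNumber k ⊗[k] V) :=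
  defEquiv.symm.toLinearMap ∘ₗ f.baseChange (DualNumber k) ∘ₗ defEquiv.toLinearMap


section Deformation

variable {k : Type*} [CommRing k] {V : Type*} [AddCommGroup V] [Module k V]
  {M N P : Type*} [AddCommGroup M] [Module k M] [AddCommGroup N] [Module k N]
  [AddCommGroup P] [Module k P]

/-- The `k[ℏ]/(ℏ²)`-linear map `f + ℏg` between the base changes of `M` and `N`. -/
def firstOrder (f g : M →ₗ[k] N) :
    DualNumber k ⊗[k] M →ₗ[DualNumber k] DualNumber k ⊗[k] N :=
  f.baseChange (DualNumber k) + (DualNumber.eps : DualNumber k) • g.baseChange (DualNumber k)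

theorem firstOrder_tmul (f g : M →ₗ[k] N) (a : DualNumber k) (x : M) :
    firstOrder f g (a ⊗ₜ x) = a ⊗ₜ f x + (DualNumber.eps * a) ⊗ₜ g x := by
  simp [firstOrder, TensorProduct.smul_tmul']

theorem firstOrder_comp (f g : N →ₗ[k] P) (f' g' : M →ₗ[k] N) :
    firstOrder f g ∘ₗ firstOrder f' g' = firstOrder (f ∘ₗ f') (f ∘ₗ g' + g ∘ₗ f') := by
  ext x
  simp [firstOrder_tmul, TensorProduct.tmul_add]
  abel

theorem firstOrder_comp_comp {X : Type*} [AddCommMonoid X] [Module (DualNumber k) X]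
    (f g : N →ₗ[k] P) (f' g' : M →ₗ[k] N) (u : X →ₗ[DualNumber k] DualNumber k ⊗[k] M) :
    firstOrder f g ∘ₗ firstOrder f' g' ∘ₗ u = firstOrder (f ∘ₗ f') (f ∘ₗ g' + g ∘ₗ f') ∘ₗ u := by
  rw [← LinearMap.comp_assoc, firstOrder_comp]

theorem equiv_comp_symm_comp {A X Y Z : Type*} [Semiring A] [AddCommMonoid X] [Module A X]
    [AddCommMonoid Y] [Module A Y] [AddCommMonoid Z] [Module A Z] (e : X ≃ₗ[A] Y) (f : Z →ₗ[A] Y) :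
    e.toLinearMap ∘ₗ e.symm.toLinearMap ∘ₗ f = f := by
  ext; simp

theorem firstOrder_inj {f g f' g' : M →ₗ[k] N} :
    firstOrder f g = firstOrder f' g' ↔ f = f' ∧ g = g' := by
  refine ⟨fun h => ?_, by rintro ⟨rfl, rfl⟩; rfl⟩
  have key (x : M) : (1 : DualNumber k) ⊗ₜ[k] f x + (DualNumber.eps : DualNumber k) ⊗ₜ[k] g x =
      1 ⊗ₜ f' x + (DualNumber.eps : DualNumber k) ⊗ₜ g' x := by
    simpa [firstOrder_tmul] using LinearMap.congr_fun h (1 ⊗ₜ x)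
  constructor <;> ext x
  · simpa using congrArg (TensorProduct.lid k N ∘
      (TrivSqZeroExt.fstHom k k k).toLinearMap.rTensor N) (key x)
  · simpa using congrArg (TensorProduct.lid k N ∘
      (TrivSqZeroExt.sndHom k k).rTensor N) (key x)

/-- The canonical identification `Ṽ ⊗ Ṽ ⊗ Ṽ ≅ (k[ℏ]/(ℏ²)) ⊗ (V ⊗ V ⊗ V)`. -/
def defEquiv₃ :
    ((DualNumber k ⊗[k] V) ⊗[DualNumber k] (DualNumber k ⊗[k] V)) ⊗[DualNumber k]
      (DualNumber k ⊗[k] V) ≃ₗ[DualNumber k] DualNumber k ⊗[k] ((V ⊗[k] V) ⊗[k] V) :=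
  TensorProduct.congr defEquiv (LinearEquiv.refl _ _) ≪≫ₗ
    (TensorProduct.AlgebraTensorModule.distribBaseChange k (DualNumber k) (V ⊗[k] V) V).symm

theorem defEquiv_symm_tmul (a : DualNumber k) (x y : V) :
    defEquiv.symm (a ⊗ₜ[k] (x ⊗ₜ[k] y)) = (a ⊗ₜ x) ⊗ₜ (1 ⊗ₜ y) :=
  rfl

theorem defEquiv₃_symm_tmul (a : DualNumber k) (t : V ⊗[k] V) (z : V) :
    defEquiv₃.symm (a ⊗ₜ[k] (t ⊗ₜ[k] z)) = defEquiv.symm (a ⊗ₜ t) ⊗ₜ (1 ⊗ₜ z) :=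
  rfl

theorem assoc_defEquiv₃_symm (a : DualNumber k) (x y z : V) :
    TensorProduct.assoc _ _ _ _ (defEquiv₃.symm (a ⊗ₜ[k] ((x ⊗ₜ[k] y) ⊗ₜ[k] z))) =
      (a ⊗ₜ x) ⊗ₜ defEquiv.symm (1 ⊗ₜ (y ⊗ₜ z)) :=
  rfl

theorem tmul_tmul_tmul_eq_defEquiv_symm (a b : DualNumber k) (x y : V) :
    (a ⊗ₜ[k] x) ⊗ₜ[DualNumber k] (b ⊗ₜ[k] y) = defEquiv.symm ((a * b) ⊗ₜ (x ⊗ₜ y)) := by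
  rw [LinearEquiv.eq_symm_apply]
  exact TensorProduct.AlgebraTensorModule.distribBaseChange_symm_tmul ..

theorem assoc_symm_tmul_defEquiv_symm (a b : DualNumber k) (x : V) (t : V ⊗[k] V) :
    (TensorProduct.assoc _ _ _ _).symm ((a ⊗ₜ[k] x) ⊗ₜ[DualNumber k] defEquiv.symm (b ⊗ₜ t)) =
      defEquiv₃.symm ((a * b) ⊗ₜ ((TensorProduct.assoc k V V V).symm (x ⊗ₜ t))) := by
  induction t with
  | zero => simp
  | tmul y z =>
    rw [defEquiv_symm_tmul, TensorProduct.assoc_symm_tmul, TensorProduct.assoc_symm_tmul,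
      tmul_tmul_tmul_eq_defEquiv_symm, defEquiv₃_symm_tmul]
  | add s t hs ht => simp only [TensorProduct.tmul_add, map_add, hs, ht]

/-- The deformation `f + ℏg` of a map `f : V ⊗ V → V`. -/
def deform21 (f g : V ⊗[k] V →ₗ[k] V) :
    (DualNumber k ⊗[k] V) ⊗[DualNumber k] (DualNumber k ⊗[k] V) →ₗ[DualNumber k]
      DualNumber k ⊗[k] V :=
  firstOrder f g ∘ₗ defEquiv.toLinearMap

/-- The deformation `f + ℏg` of a map `f : V ⊗ V → V ⊗ V`. -/
def deform22 (f g : V ⊗[k] V →ₗ[k] V ⊗[k] V) :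
    (DualNumber k ⊗[k] V) ⊗[DualNumber k] (DualNumber k ⊗[k] V) →ₗ[DualNumber k]
      (DualNumber k ⊗[k] V) ⊗[DualNumber k] (DualNumber k ⊗[k] V) :=
  defEquiv.symm.toLinearMap ∘ₗ firstOrder f g ∘ₗ defEquiv.toLinearMap

theorem ext21_add_eps_smul (f g : V ⊗[k] V →ₗ[k] V) :
    ext21 f + (DualNumber.eps : DualNumber k) • ext21 g = deform21 f g :=
  rfl

theorem ext22_add_eps_smul (f g : V ⊗[k] V →ₗ[k] V ⊗[k] V) :
    ext22 f + (DualNumber.eps : DualNumber k) • ext22 g = deform22 f g := by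
  refine LinearMap.ext fun x => ?_
  simp [ext22, deform22, firstOrder]

theorem rT2_deform22 (f g : V ⊗[k] V →ₗ[k] V ⊗[k] V) :
    rT2 (deform22 f g) =
      defEquiv₃.symm.toLinearMap ∘ₗ firstOrder (rT2 f) (rT2 g) ∘ₗ defEquiv₃.toLinearMap := by
  rw [← LinearMap.comp_assoc, ← LinearEquiv.comp_toLinearMap_symm_eq]
  ext x y z
  simp [rT2, deform22, defEquiv₃_symm_tmul, firstOrder_tmul, TensorProduct.add_tmul]

theorem lT2_deform22 (f g : V ⊗[k] V →ₗ[k] V ⊗[k] V) :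
    lT2 (deform22 f g) =
      defEquiv₃.symm.toLinearMap ∘ₗ firstOrder (lT2 f) (lT2 g) ∘ₗ defEquiv₃.toLinearMap := by
  rw [← LinearMap.comp_assoc, ← LinearEquiv.comp_toLinearMap_symm_eq]
  ext x y z
  simp [lT2, deform22, assoc_defEquiv₃_symm, assoc_symm_tmul_defEquiv_symm, firstOrder_tmul,
    TensorProduct.tmul_add]

theorem rT21_deform21 (f g : V ⊗[k] V →ₗ[k] V) :
    rT21 (deform21 f g) =
      defEquiv.symm.toLinearMap ∘ₗ firstOrder (rT21 f) (rT21 g) ∘ₗ defEquiv₃.toLinearMap := by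
  rw [← LinearMap.comp_assoc, ← LinearEquiv.comp_toLinearMap_symm_eq]
  ext x y z
  simp [rT21, deform21, defEquiv₃_symm_tmul, tmul_tmul_tmul_eq_defEquiv_symm, firstOrder_tmul,
    TensorProduct.add_tmul]

theorem lT21_deform21 (f g : V ⊗[k] V →ₗ[k] V) :
    lT21 (deform21 f g) =
      defEquiv.symm.toLinearMap ∘ₗ firstOrder (lT21 f) (lT21 g) ∘ₗ defEquiv₃.toLinearMap := by
  rw [← LinearMap.comp_assoc, ← LinearEquiv.comp_toLinearMap_symm_eq]
  ext x y z
  simp [lT21, deform21, assoc_defEquiv₃_symm, tmul_tmul_tmul_eq_defEquiv_symm, firstOrder_tmul,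
    TensorProduct.tmul_add]

theorem d2YB_eq_zero_iff (R φ : V ⊗[k] V →ₗ[k] V ⊗[k] V) :
    d2YB R φ = 0 ↔
      rT2 R ∘ₗ lT2 R ∘ₗ rT2 φ + rT2 R ∘ₗ lT2 φ ∘ₗ rT2 R + rT2 φ ∘ₗ lT2 R ∘ₗ rT2 R =
        lT2 R ∘ₗ rT2 R ∘ₗ lT2 φ + lT2 R ∘ₗ rT2 φ ∘ₗ lT2 R + lT2 φ ∘ₗ rT2 R ∘ₗ lT2 R := by
  simp only [d2YB, LinearMap.ext_iff, LinearMap.sub_apply, LinearMap.add_apply,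
    LinearMap.zero_apply, sub_sub, sub_eq_zero]

end Deformation

/-- for a braided commutative braided algebra `(V, μ, R)` and
linear maps `ψ : V⊗V → V`, `φ : V⊗V → V⊗V`, the deformed structure
`μ̃ = μ + ℏψ`, `R̃ = R + ℏφ` on `Ṽ = V ⊗ k[ℏ]/(ℏ²)` is an associative
multiplication with a Yang-Baxter operator satisfying YI, IY and braided
commutativity (i.e. a braided commutative infinitesimal deformation) if and
only if `(φ, ψ)` is a braided commutative 2-cocycle. -/
theorem infinitesimal_BC_deformation_iff_two_cocycle {k : Type*} [CommRing k]
    {V : Type*} [AddCommGroup V] [Module k V]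
    (μ : V ⊗[k] V →ₗ[k] V) (R : V ⊗[k] V →ₗ[k] V ⊗[k] V)
    (hBA : IsBraidedAlgebra μ R) (hBC : μ ∘ₗ R = μ)
    (ψ : V ⊗[k] V →ₗ[k] V) (φ : V ⊗[k] V →ₗ[k] V ⊗[k] V) :
    (letI tμ := ext21 μ + (DualNumber.eps : DualNumber k) • ext21 ψ
     letI tR := ext22 R + (DualNumber.eps : DualNumber k) • ext22 φ
     tμ ∘ₗ rT21 tμ = tμ ∘ₗ lT21 tμ ∧
     rT2 tR ∘ₗ lT2 tR ∘ₗ rT2 tR = lT2 tR ∘ₗ rT2 tR ∘ₗ lT2 tR ∧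
     lT21 tμ ∘ₗ rT2 tR ∘ₗ lT2 tR = tR ∘ₗ rT21 tμ ∧
     rT21 tμ ∘ₗ lT2 tR ∘ₗ rT2 tR = tR ∘ₗ lT21 tμ ∧
     tμ ∘ₗ tR = tμ) ↔
    (d2YB R φ = 0 ∧ d2YI μ R φ ψ = 0 ∧ d2IY μ R φ ψ = 0 ∧ d2H μ ψ = 0 ∧
      μ ∘ₗ φ + ψ ∘ₗ R - ψ = 0) := by
  rw [ext21_add_eps_smul, ext22_add_eps_smul, rT2_deform22, lT2_deform22, rT21_deform21,
    lT21_deform21]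
  simp only [deform21, deform22, LinearMap.comp_assoc, equiv_comp_symm_comp,
    firstOrder_comp_comp, LinearEquiv.comp_toLinearMap_eq_iff,
    LinearEquiv.eq_comp_toLinearMap_iff, firstOrder_inj,
    hBA.assoc, hBA.yb, hBA.yi, hBA.iy, hBC, true_and, LinearMap.comp_add]
  simp only [d2YB_eq_zero_iff, d2YI, d2IY, d2H, sub_sub, sub_eq_zero]
  rw [add_comm (_ + _) (lT21 ψ ∘ₗ _), add_comm (_ + _) (rT21 ψ ∘ₗ _),
    add_comm (lT21 μ ∘ₗ _), add_comm (rT21 μ ∘ₗ _), ← add_assoc, ← add_assoc]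
  tauto

end
end

section
/- Let (V, μ, R) be a braided commutative braided algebra over a commutative ring k, and let ψ : V⊗V → V and φ : V⊗V → V⊗V be arbitrary linear maps. Set α = δ²_YI(φ,ψ), α' = δ²_IY(φ,ψ), β = δ²_YB(φ), and τ = μφ + ψR − ψ. Then δ³_BC:YI(α, β, τ) = 0 and δ³_BC:IY(α', β, τ) = 0. Consequently δ³_BC ∘ δ²_BC = 0, so the braided commutative cochain groups with differentials δ¹_BC, δ²_BC, δ³_BC form a cochain complex up to degree 4. -/
open TensorProduct LinearMap

noncomputable section

variable {k : Type*} [CommRing k] {V : Type*} [AddCommGroup V] [Module k V]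

/-- YI braided-commutativity component of the third differential. -/
def d3BCYI (μ : V ⊗[k] V →ₗ[k] V) (R : V ⊗[k] V →ₗ[k] V ⊗[k] V)
    (α : (V ⊗[k] V) ⊗[k] V →ₗ[k] V ⊗[k] V)
    (β : (V ⊗[k] V) ⊗[k] V →ₗ[k] (V ⊗[k] V) ⊗[k] V)
    (τ : V ⊗[k] V →ₗ[k] V) : (V ⊗[k] V) ⊗[k] V →ₗ[k] V ⊗[k] V :=
  α ∘ₗ rT2 R + R ∘ₗ rT21 τ - lT21 μ ∘ₗ β - lT21 τ ∘ₗ rT2 R ∘ₗ lT2 R - α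

/-- IY braided-commutativity component of the third differential. -/
def d3BCIY (μ : V ⊗[k] V →ₗ[k] V) (R : V ⊗[k] V →ₗ[k] V ⊗[k] V)
    (α : (V ⊗[k] V) ⊗[k] V →ₗ[k] V ⊗[k] V)
    (β : (V ⊗[k] V) ⊗[k] V →ₗ[k] (V ⊗[k] V) ⊗[k] V)
    (τ : V ⊗[k] V →ₗ[k] V) : (V ⊗[k] V) ⊗[k] V →ₗ[k] V ⊗[k] V :=
  rT21 μ ∘ₗ β + α ∘ₗ lT2 R + R ∘ₗ lT21 τ - rT21 τ ∘ₗ lT2 R ∘ₗ rT2 R - α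


section CompositionLemmas

variable (f h h' : V ⊗[k] V →ₗ[k] V) (g : V ⊗[k] V →ₗ[k] V ⊗[k] V)

theorem rT21_comp : rT21 (f ∘ₗ g) = rT21 f ∘ₗ rT2 g :=
  LinearMap.rTensor_comp V f g

theorem lT21_comp : lT21 (f ∘ₗ g) = lT21 f ∘ₗ lT2 g := by
  ext x y z
  simp [lT21, lT2]

theorem rT21_add : rT21 (h + h') = rT21 h + rT21 h' :=
  LinearMap.rTensor_add V h h'

theorem rT21_sub : rT21 (h - h') = rT21 h - rT21 h' :=
  LinearMap.rTensor_sub h h'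

theorem lT21_add : lT21 (h + h') = lT21 h + lT21 h' := by
  simp only [lT21, LinearMap.lTensor_add, LinearMap.add_comp]

theorem lT21_sub : lT21 (h - h') = lT21 h - lT21 h' := by
  simp only [lT21, LinearMap.lTensor_sub, LinearMap.sub_comp]

end CompositionLemmas

/-- for a braided commutative braided algebra,
`δ³_BC:YI(δ²_YI(φ,ψ), δ²_YB(φ), μφ + ψR − ψ) = 0` and
`δ³_BC:IY(δ²_IY(φ,ψ), δ²_YB(φ), μφ + ψR − ψ) = 0`; consequently
`δ³_BC ∘ δ²_BC = 0` and the braided commutative cochain groups form a cochain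
complex up to degree 4. -/
theorem d3BC_d2BC_eq_zero {k : Type*} [CommRing k] {V : Type*} [AddCommGroup V]
    [Module k V] (μ : V ⊗[k] V →ₗ[k] V) (R : V ⊗[k] V →ₗ[k] V ⊗[k] V)
    (hBA : IsBraidedAlgebra μ R) (hBC : μ ∘ₗ R = μ)
    (ψ : V ⊗[k] V →ₗ[k] V) (φ : V ⊗[k] V →ₗ[k] V ⊗[k] V) :
    d3BCYI μ R (d2YI μ R φ ψ) (d2YB R φ) (μ ∘ₗ φ + ψ ∘ₗ R - ψ) = 0 ∧
    d3BCIY μ R (d2IY μ R φ ψ) (d2YB R φ) (μ ∘ₗ φ + ψ ∘ₗ R - ψ) = 0 := by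
  have yb (x) : rT2 R (lT2 R (rT2 R x)) = lT2 R (rT2 R (lT2 R x)) :=
    LinearMap.congr_fun hBA.yb x
  have yi (x) : lT21 μ (rT2 R (lT2 R x)) = R (rT21 μ x) := LinearMap.congr_fun hBA.yi x
  have iy (x) : rT21 μ (lT2 R (rT2 R x)) = R (lT21 μ x) := LinearMap.congr_fun hBA.iy x
  have μr (x) : rT21 μ (rT2 R x) = rT21 μ x := by
    rw [← LinearMap.comp_apply, ← rT21_comp, hBC]
  have μl (x) : lT21 μ (lT2 R x) = lT21 μ x := by
    rw [← LinearMap.comp_apply, ← lT21_comp, hBC]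
  constructor <;> refine LinearMap.ext fun x => ?_
  · simp only [d3BCYI, d2YI, d2YB, rT21_add, rT21_sub, rT21_comp, lT21_add, lT21_sub,
      lT21_comp, LinearMap.add_apply, LinearMap.sub_apply, LinearMap.comp_apply, map_add,
      map_sub, LinearMap.zero_apply, yb, yi, μr, μl]
    abel
  · simp only [d3BCIY, d2IY, d2YB, rT21_add, rT21_sub, rT21_comp, lT21_add, lT21_sub,
      lT21_comp, LinearMap.add_apply, LinearMap.sub_apply, LinearMap.comp_apply, map_add,
      map_sub, LinearMap.zero_apply, yb, iy, μr, μl]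
    abel

end
end

section
/- Let (V, μ, R) be a braided commutative braided algebra over a commutative ring k and let (φ, ψ) be a braided commutative 2-cocycle, i.e., δ²_YB(φ) = 0, δ²_YI(φ,ψ) = 0, δ²_IY(φ,ψ) = 0, δ²_H(ψ) = 0, and μφ + ψR − ψ = 0. Define the quadratic obstructions Θ₂ = (φ⊗1)(1⊗φ)(R⊗1) + (φ⊗1)(1⊗R)(φ⊗1) + (R⊗1)(1⊗φ)(φ⊗1) − (1⊗φ)(φ⊗1)(1⊗R) − (1⊗φ)(R⊗1)(1⊗φ) − (1⊗R)(φ⊗1)(1⊗φ), Ξ^{YI}₂ = (1⊗ψ)(φ⊗1)(1⊗R) + (1⊗ψ)(R⊗1)(1⊗φ) + (1⊗μ)(φ⊗1)(1⊗φ), Ω^{YI}₂ = φ(ψ⊗1), Ξ^{IY}₂ = (ψ⊗1)(1⊗φ)(R⊗1) + (ψ⊗1)(1⊗R)(φ⊗1) + (μ⊗1)(1⊗φ)(φ⊗1), Ω^{IY}₂ = φ(1⊗ψ), and Υ₂ = ψφ. Then δ³_BC:YI(Ξ^{YI}₂ − Ω^{YI}₂, Θ₂, Υ₂) = 0 and δ³_BC:IY(Ξ^{IY}₂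 − Ω^{IY}₂, Θ₂, Υ₂) = 0; hence the obstruction to extending a braided commutative infinitesimal deformation to a quadratic braided commutative deformation is a braided commutative 3-cocycle. -/
open TensorProduct LinearMap

noncomputable section

variable {k : Type*} [CommRing k] {V : Type*} [AddCommGroup V] [Module k V]

theorem rT21_comp_rT2 {k : Type*} [CommRing k] {V : Type*} [AddCommGroup V] [Module k V]
    (h : V ⊗[k] V →ₗ[k] V) (g : V ⊗[k] V →ₗ[k] V ⊗[k] V) :
    rT21 (h ∘ₗ g) = rT21 h ∘ₗ rT2 g :=
  LinearMap.rTensor_comp V h g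

theorem lT21_comp_lT2 {k : Type*} [CommRing k] {V : Type*} [AddCommGroup V] [Module k V]
    (h : V ⊗[k] V →ₗ[k] V) (g : V ⊗[k] V →ₗ[k] V ⊗[k] V) :
    lT21 (h ∘ₗ g) = lT21 h ∘ₗ lT2 g := by
  ext x y z
  simp [lT21, lT2]

/-- The second-order coefficient of the identity
`E A - E = (M B - M) A B + M (A B A - B A B) - R (N A - N)` with `E = M A B - R N`, for the
first-order deformations `A = a + t p`, `B = b + t q`, `M = m + t s`, `N = n + t u`,
`R = r + t f`. -/
theorem second_order_obstruction_eq_zero {k W₃ W₂ : Type*} [CommRing k]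
    [AddCommGroup W₃] [Module k W₃] [AddCommGroup W₂] [Module k W₂]
    {a b p q : W₃ →ₗ[k] W₃} {m s n u : W₃ →ₗ[k] W₂} {r f : W₂ →ₗ[k] W₂}
    (hm : m ∘ₗ b = m) (hs : m ∘ₗ q + s ∘ₗ b - s = 0) (hu : n ∘ₗ p + u ∘ₗ a - u = 0)
    (hyb : a ∘ₗ b ∘ₗ p + a ∘ₗ q ∘ₗ a + p ∘ₗ b ∘ₗ a
      - b ∘ₗ a ∘ₗ q - b ∘ₗ p ∘ₗ b - q ∘ₗ a ∘ₗ b = 0)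
    (hE : s ∘ₗ a ∘ₗ b + m ∘ₗ p ∘ₗ b + m ∘ₗ a ∘ₗ q - r ∘ₗ u - f ∘ₗ n = 0) :
    ((s ∘ₗ p ∘ₗ b + s ∘ₗ a ∘ₗ q + m ∘ₗ p ∘ₗ q) - f ∘ₗ u) ∘ₗ a + r ∘ₗ u ∘ₗ p
      - m ∘ₗ (p ∘ₗ q ∘ₗ a + p ∘ₗ b ∘ₗ p + a ∘ₗ q ∘ₗ p
        - q ∘ₗ p ∘ₗ b - q ∘ₗ a ∘ₗ q - b ∘ₗ p ∘ₗ q)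
      - (s ∘ₗ q) ∘ₗ a ∘ₗ b
      - ((s ∘ₗ p ∘ₗ b + s ∘ₗ a ∘ₗ q + m ∘ₗ p ∘ₗ q) - f ∘ₗ u) = 0 := by
  ext x
  have e₀ := LinearMap.congr_fun hm (p (q x))
  have e₁ := LinearMap.congr_fun hs (p (b x))
  have e₂ := LinearMap.congr_fun hs (a (q x))
  have e₃ := congrArg s (LinearMap.congr_fun hyb x)
  have e₄ := congrArg f (LinearMap.congr_fun hu x)
  have e₅ := LinearMap.congr_fun hE (p x)
  simp only [LinearMap.add_apply, LinearMap.sub_apply, LinearMap.comp_apply,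
    LinearMap.zero_apply, map_add, map_sub, map_zero] at e₀ e₁ e₂ e₃ e₄ e₅ ⊢
  linear_combination (norm := module) e₀ + e₁ + e₂ + e₃ - e₄ - e₅

/-- for a braided commutative braided algebra and a braided
commutative 2-cocycle `(φ, ψ)`, the quadratic obstructions are annihilated by
the braided commutative third differential components; hence the obstruction to
extending a braided commutative infinitesimal deformation to a quadratic one is
a braided commutative 3-cocycle. -/
theorem quadratic_obstruction_is_BC_three_cocycle {k : Type*} [CommRing k]
    {V : Type*} [AddCommGroup V] [Module k V]
    (μ : V ⊗[k] V →ₗ[k] V) (R : V ⊗[k] V →ₗ[k] V ⊗[k] V)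
    (hBA : IsBraidedAlgebra μ R) (hBC : μ ∘ₗ R = μ)
    (ψ : V ⊗[k] V →ₗ[k] V) (φ : V ⊗[k] V →ₗ[k] V ⊗[k] V)
    (h1 : d2YB R φ = 0) (h2 : d2YI μ R φ ψ = 0) (h3 : d2IY μ R φ ψ = 0)
    (h4 : d2H μ ψ = 0) (h5 : μ ∘ₗ φ + ψ ∘ₗ R - ψ = 0) :
    d3BCYI μ R
      ((lT21 ψ ∘ₗ rT2 φ ∘ₗ lT2 R + lT21 ψ ∘ₗ rT2 R ∘ₗ lT2 φ
          + lT21 μ ∘ₗ rT2 φ ∘ₗ lT2 φ) - φ ∘ₗ rT21 ψ)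
      (rT2 φ ∘ₗ lT2 φ ∘ₗ rT2 R + rT2 φ ∘ₗ lT2 R ∘ₗ rT2 φ
        + rT2 R ∘ₗ lT2 φ ∘ₗ rT2 φ - lT2 φ ∘ₗ rT2 φ ∘ₗ lT2 R
        - lT2 φ ∘ₗ rT2 R ∘ₗ lT2 φ - lT2 R ∘ₗ rT2 φ ∘ₗ lT2 φ)
      (ψ ∘ₗ φ) = 0 ∧
    d3BCIY μ R
      ((rT21 ψ ∘ₗ lT2 φ ∘ₗ rT2 R + rT21 ψ ∘ₗ lT2 R ∘ₗ rT2 φ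
          + rT21 μ ∘ₗ lT2 φ ∘ₗ rT2 φ) - φ ∘ₗ lT21 ψ)
      (rT2 φ ∘ₗ lT2 φ ∘ₗ rT2 R + rT2 φ ∘ₗ lT2 R ∘ₗ rT2 φ
        + rT2 R ∘ₗ lT2 φ ∘ₗ rT2 φ - lT2 φ ∘ₗ rT2 φ ∘ₗ lT2 R
        - lT2 φ ∘ₗ rT2 R ∘ₗ lT2 φ - lT2 R ∘ₗ rT2 φ ∘ₗ lT2 φ)
      (ψ ∘ₗ φ) = 0 := by
  have hr : rT21 μ ∘ₗ rT2 R = rT21 μ := by rw [← rT21_comp_rT2, hBC]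
  have hl : lT21 μ ∘ₗ lT2 R = lT21 μ := by rw [← lT21_comp_lT2, hBC]
  have hr' : rT21 μ ∘ₗ rT2 φ + rT21 ψ ∘ₗ rT2 R - rT21 ψ = 0 := by
    have h := congrArg (LinearMap.rTensor V) h5
    rwa [LinearMap.rTensor_sub, LinearMap.rTensor_add, LinearMap.rTensor_zero,
      LinearMap.rTensor_comp, LinearMap.rTensor_comp] at h
  have hl' : lT21 μ ∘ₗ lT2 φ + lT21 ψ ∘ₗ lT2 R - lT21 ψ = 0 := by
    have h := congrArg lT21 h5
    rw [← lT21_comp_lT2, ← lT21_comp_lT2]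
    simpa only [lT21, LinearMap.lTensor_sub, LinearMap.lTensor_add, LinearMap.lTensor_zero,
      LinearMap.sub_comp, LinearMap.add_comp, LinearMap.zero_comp] using h
  constructor
  · rw [d3BCYI, rT21_comp_rT2, lT21_comp_lT2]
    exact second_order_obstruction_eq_zero hl hl' hr' h1 h2
  · rw [d3BCIY, rT21_comp_rT2, lT21_comp_lT2]
    have hyb : lT2 R ∘ₗ rT2 R ∘ₗ lT2 φ + lT2 R ∘ₗ rT2 φ ∘ₗ lT2 R + lT2 φ ∘ₗ rT2 R ∘ₗ lT2 R
        - rT2 R ∘ₗ lT2 R ∘ₗ rT2 φ - rT2 R ∘ₗ lT2 φ ∘ₗ rT2 R - rT2 φ ∘ₗ lT2 R ∘ₗ rT2 R = 0 := by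
      refine LinearMap.ext fun x => ?_
      have h := LinearMap.congr_fun h1 x
      simp only [d2YB, LinearMap.add_apply, LinearMap.sub_apply, LinearMap.zero_apply] at h ⊢
      linear_combination (norm := module) -h
    rw [← second_order_obstruction_eq_zero hr hr' hl' hyb h3]
    simp only [LinearMap.comp_add, LinearMap.comp_sub]
    abel

end
end

section
/- Let (V, μ, R) be a braided commutative braided algebra over a commutative ring k and let ψᵢ : V⊗V → V and φᵢ : V⊗V → V⊗V (1 ≤ i ≤ n+1) be linear maps, with ψ₀ = μ, φ₀ = R. For 0 ≤ m ≤ n+1 let V_m = V ⊗_k (k[ℏ]/(ℏ^{m+1})) and let μ_m = Σ_{i=0}^{m} ℏⁱψᵢ and R_m = Σ_{i=0}^{m} ℏⁱφᵢ, extended ℏ-linearly. Suppose (V_n, μ_n, R_n) satisfies associativity, the Yang–Baxter equation, the YI and IY conditions, and braided commutativity μ_nR_n = μ_n. Then (V_{n+1}, μ_{n+1}, R_{n+1}) satisfies associativity, the Yang–Baxter equation, YI, IY, and braided commutativity if and only if: δ²_YB(φ_{n+1}) + Θ_{n+1} = 0; δ²_IY(φ_{n+1}, ψ_{n+1}) +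 Ξ^{IY}_{n+1} − Ω^{IY}_{n+1} = 0; δ²_YI(φ_{n+1}, ψ_{n+1}) + Ξ^{YI}_{n+1} − Ω^{YI}_{n+1} = 0; δ²_H(ψ_{n+1}) + Λ_{n+1} = 0; and μφ_{n+1} + ψ_{n+1}R − ψ_{n+1} + Υ_{n+1} = 0. -/
open TensorProduct LinearMap

noncomputable section

variable {k : Type*} [CommRing k] {V : Type*} [AddCommGroup V] [Module k V]

/-- The index set `Γ_r = {(i,j,k) : i+j+k = r, i,j,k ≠ r}`. -/
def Gam (r : ℕ) : Finset (ℕ × ℕ × ℕ) :=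
  (Finset.range (r+1) ×ˢ Finset.range (r+1) ×ˢ Finset.range (r+1)).filter
    (fun p => p.1 + p.2.1 + p.2.2 = r ∧ p.1 ≠ r ∧ p.2.1 ≠ r ∧ p.2.2 ≠ r)

/-- The index set of triples `(p,q,0) ∈ Γ_r`. -/
def Gam2 (r : ℕ) : Finset (ℕ × ℕ) :=
  (Finset.range (r+1) ×ˢ Finset.range (r+1)).filter
    (fun p => p.1 + p.2 + 0 = r ∧ p.1 ≠ r ∧ p.2 ≠ r ∧ (0 : ℕ) ≠ r)

/-- `Θ_r = Σ_{(i,j,k)∈Γ_r} (φᵢ⊗1)(1⊗φⱼ)(φ_k⊗1) − (1⊗φᵢ)(φⱼ⊗1)(1⊗φ_k)`. -/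
def Theta (φ : ℕ → V ⊗[k] V →ₗ[k] V ⊗[k] V) (r : ℕ) :
    (V ⊗[k] V) ⊗[k] V →ₗ[k] (V ⊗[k] V) ⊗[k] V :=
  ∑ p ∈ Gam r,
    (rT2 (φ p.1) ∘ₗ lT2 (φ p.2.1) ∘ₗ rT2 (φ p.2.2)
      - lT2 (φ p.1) ∘ₗ rT2 (φ p.2.1) ∘ₗ lT2 (φ p.2.2))

/-- `Ξ^{YI}_r = Σ_{(i,j,k)∈Γ_r} (1⊗ψᵢ)(φⱼ⊗1)(1⊗φ_k)`. -/
def XiYI (ψ : ℕ → V ⊗[k] V →ₗ[k] V) (φ : ℕ → V ⊗[k] V →ₗ[k] V ⊗[k] V) (r : ℕ) :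
    (V ⊗[k] V) ⊗[k] V →ₗ[k] V ⊗[k] V :=
  ∑ p ∈ Gam r, lT21 (ψ p.1) ∘ₗ rT2 (φ p.2.1) ∘ₗ lT2 (φ p.2.2)

/-- `Ω^{YI}_r = Σ_{(p,q,0)∈Γ_r} φ_p (ψ_q⊗1)`. -/
def OmYI (ψ : ℕ → V ⊗[k] V →ₗ[k] V) (φ : ℕ → V ⊗[k] V →ₗ[k] V ⊗[k] V) (r : ℕ) :
    (V ⊗[k] V) ⊗[k] V →ₗ[k] V ⊗[k] V :=
  ∑ p ∈ Gam2 r, φ p.1 ∘ₗ rT21 (ψ p.2)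

/-- `Ξ^{IY}_r = Σ_{(i,j,k)∈Γ_r} (ψᵢ⊗1)(1⊗φⱼ)(φ_k⊗1)`. -/
def XiIY (ψ : ℕ → V ⊗[k] V →ₗ[k] V) (φ : ℕ → V ⊗[k] V →ₗ[k] V ⊗[k] V) (r : ℕ) :
    (V ⊗[k] V) ⊗[k] V →ₗ[k] V ⊗[k] V :=
  ∑ p ∈ Gam r, rT21 (ψ p.1) ∘ₗ lT2 (φ p.2.1) ∘ₗ rT2 (φ p.2.2)

/-- `Ω^{IY}_r = Σ_{(p,q,0)∈Γ_r} φ_p (1⊗ψ_q)`. -/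
def OmIY (ψ : ℕ → V ⊗[k] V →ₗ[k] V) (φ : ℕ → V ⊗[k] V →ₗ[k] V ⊗[k] V) (r : ℕ) :
    (V ⊗[k] V) ⊗[k] V →ₗ[k] V ⊗[k] V :=
  ∑ p ∈ Gam2 r, φ p.1 ∘ₗ lT21 (ψ p.2)

/-- `Λ_r = Σ_{(p,q,0)∈Γ_r} ψ_p(ψ_q⊗1) − ψ_p(1⊗ψ_q)`. -/
def Lam (ψ : ℕ → V ⊗[k] V →ₗ[k] V) (r : ℕ) :
    (V ⊗[k] V) ⊗[k] V →ₗ[k] V :=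
  ∑ p ∈ Gam2 r, (ψ p.1 ∘ₗ rT21 (ψ p.2) - ψ p.1 ∘ₗ lT21 (ψ p.2))

/-- `Υ_r = Σ_{(i,j,0)∈Γ_r} ψᵢ φⱼ`. -/
def Ups (ψ : ℕ → V ⊗[k] V →ₗ[k] V) (φ : ℕ → V ⊗[k] V →ₗ[k] V ⊗[k] V) (r : ℕ) :
    V ⊗[k] V →ₗ[k] V :=
  ∑ p ∈ Gam2 r, ψ p.1 ∘ₗ φ p.2


set_option synthInstance.maxHeartbeats 1000000
set_option maxHeartbeats 1000000

/-- The truncated polynomial ring `k[ℏ]/(ℏ^{m+1})`. -/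
abbrev TruncPoly (k : Type*) [CommRing k] (m : ℕ) : Type _ :=
  Polynomial k ⧸ Ideal.span {(Polynomial.X : Polynomial k) ^ (m + 1)}

/-- The class `ℏ` of `X` in `k[ℏ]/(ℏ^{m+1})`. -/
def hbar (k : Type*) [CommRing k] (m : ℕ) : TruncPoly k m :=
  Ideal.Quotient.mk _ Polynomial.X

/-- The canonical `A`-linear identification
`(A ⊗ V) ⊗[A] (A ⊗ V) ≅ A ⊗ (V ⊗ V)` for a commutative `k`-algebra `A`. -/
def defEquivA {k : Type*} [CommRing k] (A : Type*) [CommRing A] [Algebra k A]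
    {V : Type*} [AddCommGroup V] [Module k V] :
    (A ⊗[k] V) ⊗[A] (A ⊗[k] V) ≃ₗ[A] A ⊗[k] (V ⊗[k] V) :=
  (TensorProduct.AlgebraTensorModule.distribBaseChange k A V V).symm

/-- Linear extension of a map `V ⊗ V → V` to `(A ⊗ V) ⊗[A] (A ⊗ V) → A ⊗ V`. -/
def ext21A {k : Type*} [CommRing k] (A : Type*) [CommRing A] [Algebra k A]
    {V : Type*} [AddCommGroup V] [Module k V] (f : V ⊗[k] V →ₗ[k] V) :
    (A ⊗[k] V) ⊗[A] (A ⊗[k] V) →ₗ[A] A ⊗[k] V :=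
  f.baseChange A ∘ₗ (defEquivA A).toLinearMap

/-- Linear extension of a map `V ⊗ V → V ⊗ V`. -/
def ext22A {k : Type*} [CommRing k] (A : Type*) [CommRing A] [Algebra k A]
    {V : Type*} [AddCommGroup V] [Module k V] (f : V ⊗[k] V →ₗ[k] V ⊗[k] V) :
    (A ⊗[k] V) ⊗[A] (A ⊗[k] V) →ₗ[A] (A ⊗[k] V) ⊗[A] (A ⊗[k] V) :=
  (defEquivA A).symm.toLinearMap ∘ₗ f.baseChange A ∘ₗ (defEquivA A).toLinearMap

/-- The degree-`m` deformed multiplication `μ_m = Σ_{i=0}^m ℏⁱ ψᵢ` on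
`V_m = V ⊗ k[ℏ]/(ℏ^{m+1})`. -/
def muDef {k : Type*} [CommRing k] {V : Type*} [AddCommGroup V] [Module k V]
    (ψ : ℕ → V ⊗[k] V →ₗ[k] V) (m : ℕ) :
    (TruncPoly k m ⊗[k] V) ⊗[TruncPoly k m] (TruncPoly k m ⊗[k] V)
      →ₗ[TruncPoly k m] TruncPoly k m ⊗[k] V :=
  ∑ i ∈ Finset.range (m + 1), (hbar k m) ^ i • ext21A (TruncPoly k m) (ψ i)

/-- The degree-`m` deformed braiding `R_m = Σ_{i=0}^m ℏⁱ φᵢ`. -/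
def RDef {k : Type*} [CommRing k] {V : Type*} [AddCommGroup V] [Module k V]
    (φ : ℕ → V ⊗[k] V →ₗ[k] V ⊗[k] V) (m : ℕ) :
    (TruncPoly k m ⊗[k] V) ⊗[TruncPoly k m] (TruncPoly k m ⊗[k] V)
      →ₗ[TruncPoly k m] (TruncPoly k m ⊗[k] V) ⊗[TruncPoly k m] (TruncPoly k m ⊗[k] V) :=
  ∑ i ∈ Finset.range (m + 1), (hbar k m) ^ i • ext22A (TruncPoly k m) (φ i)

/-- `(V_m, μ_m, R_m)` is a braided commutative deformation: associativity,
Yang-Baxter, YI, IY and braided commutativity all hold. -/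
def IsBCDeformation {k : Type*} [CommRing k] {V : Type*} [AddCommGroup V]
    [Module k V] (ψ : ℕ → V ⊗[k] V →ₗ[k] V)
    (φ : ℕ → V ⊗[k] V →ₗ[k] V ⊗[k] V) (m : ℕ) : Prop :=
  muDef ψ m ∘ₗ rT21 (muDef ψ m) = muDef ψ m ∘ₗ lT21 (muDef ψ m) ∧
  rT2 (RDef φ m) ∘ₗ lT2 (RDef φ m) ∘ₗ rT2 (RDef φ m) =
    lT2 (RDef φ m) ∘ₗ rT2 (RDef φ m) ∘ₗ lT2 (RDef φ m) ∧
  lT21 (muDef ψ m) ∘ₗ rT2 (RDef φ m) ∘ₗ lT2 (RDef φ m) =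
    RDef φ m ∘ₗ rT21 (muDef ψ m) ∧
  rT21 (muDef ψ m) ∘ₗ lT2 (RDef φ m) ∘ₗ rT2 (RDef φ m) =
    RDef φ m ∘ₗ lT21 (muDef ψ m) ∧
  muDef ψ m ∘ₗ RDef φ m = muDef ψ m

open Finset.HasAntidiagonal (antidiagonal mem_antidiagonal)

section SumComp

variable {A M N P : Type*} [CommSemiring A] [AddCommMonoid M] [AddCommMonoid N] [AddCommMonoid P]
  [Module A M] [Module A N] [Module A P]

theorem linearMap_sum_comp {ι : Type*} (s : Finset ι) (f : ι → N →ₗ[A] P) (g : M →ₗ[A] N) :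
    (∑ i ∈ s, f i) ∘ₗ g = ∑ i ∈ s, f i ∘ₗ g := by
  ext x
  simp

theorem linearMap_comp_sum {ι : Type*} (s : Finset ι) (f : N →ₗ[A] P) (g : ι → M →ₗ[A] N) :
    f ∘ₗ (∑ i ∈ s, g i) = ∑ i ∈ s, f ∘ₗ g i := by
  ext x
  simp

end SumComp

section BaseChange

variable (A : Type*) [CommRing A] [Algebra k A]

/-- The canonical `A`-linear identification of the threefold tensor power of `A ⊗ V` over `A`
with `A ⊗ ((V ⊗ V) ⊗ V)`. -/
def tripleEquivA :
    ((A ⊗[k] V) ⊗[A] (A ⊗[k] V)) ⊗[A] (A ⊗[k] V) ≃ₗ[A] A ⊗[k] ((V ⊗[k] V) ⊗[k] V) :=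
  (TensorProduct.congr (defEquivA A) (LinearEquiv.refl A (A ⊗[k] V))).trans
    (TensorProduct.AlgebraTensorModule.distribBaseChange k A (V ⊗[k] V) V).symm

theorem defEquivA_tmul (a b : A) (x y : V) :
    defEquivA A ((a ⊗ₜ[k] x) ⊗ₜ[A] (b ⊗ₜ[k] y)) = (b * a) ⊗ₜ[k] (x ⊗ₜ[k] y) := by
  simp [defEquivA, TensorProduct.AlgebraTensorModule.distribBaseChange,
    TensorProduct.smul_tmul']

theorem defEquivA_symm_tmul (a : A) (x y : V) :
    (defEquivA A).symm (a ⊗ₜ[k] (x ⊗ₜ[k] y)) = (a ⊗ₜ[k] x) ⊗ₜ[A] (1 ⊗ₜ[k] y) := by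
  rw [LinearEquiv.symm_apply_eq, defEquivA_tmul, one_mul]

theorem tripleEquivA_tmul (t : (A ⊗[k] V) ⊗[A] (A ⊗[k] V)) (a b : A) (w : V ⊗[k] V) (z : V)
    (ht : defEquivA A t = a ⊗ₜ[k] w) :
    tripleEquivA A (t ⊗ₜ[A] (b ⊗ₜ[k] z)) = (b * a) ⊗ₜ[k] (w ⊗ₜ[k] z) := by
  simp [tripleEquivA, ht, TensorProduct.AlgebraTensorModule.distribBaseChange,
    TensorProduct.smul_tmul']

theorem defEquivA_comp_rT21 (f : V ⊗[k] V →ₗ[k] V) :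
    (defEquivA A).toLinearMap ∘ₗ rT21 (ext21A A f) =
      (rT21 f).baseChange A ∘ₗ (tripleEquivA A).toLinearMap := by
  ext x y z
  simp [rT21, ext21A, defEquivA_tmul, tripleEquivA_tmul A _ _ _ _ _ (defEquivA_tmul A _ _ _ _)]

theorem tripleEquivA_comp_rT2 (f : V ⊗[k] V →ₗ[k] V ⊗[k] V) :
    (tripleEquivA A).toLinearMap ∘ₗ rT2 (ext22A A f) =
      (rT2 f).baseChange A ∘ₗ (tripleEquivA A).toLinearMap := by
  ext x y z
  have h : defEquivA A (ext22A A f ((1 ⊗ₜ[k] x) ⊗ₜ[A] (1 ⊗ₜ[k] y))) =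
      (1 : A) ⊗ₜ[k] f (x ⊗ₜ[k] y) := by
    simp [ext22A, defEquivA_tmul]
  simp [rT2, tripleEquivA_tmul A _ _ _ _ _ h,
    tripleEquivA_tmul A _ _ _ _ _ (defEquivA_tmul A _ _ _ _)]

theorem defEquivA_comp_lT21 (f : V ⊗[k] V →ₗ[k] V) :
    (defEquivA A).toLinearMap ∘ₗ lT21 (ext21A A f) =
      (lT21 f).baseChange A ∘ₗ (tripleEquivA A).toLinearMap := by
  ext x y z
  simp [lT21, ext21A, defEquivA_tmul, tripleEquivA_tmul A _ _ _ _ _ (defEquivA_tmul A _ _ _ _)]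

theorem tripleEquivA_comp_lT2 (f : V ⊗[k] V →ₗ[k] V ⊗[k] V) :
    (tripleEquivA A).toLinearMap ∘ₗ lT2 (ext22A A f) =
      (lT2 f).baseChange A ∘ₗ (tripleEquivA A).toLinearMap := by
  have key : ∀ (x : V) (w : V ⊗[k] V),
      tripleEquivA A ((TensorProduct.assoc A _ _ _).symm
        (((1 : A) ⊗ₜ[k] x) ⊗ₜ[A] (defEquivA A).symm (1 ⊗ₜ[k] w))) =
      (1 : A) ⊗ₜ[k] (TensorProduct.assoc k V V V).symm (x ⊗ₜ[k] w) := by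
    intro x w
    induction w with
    | zero => simp
    | tmul y z =>
      simp [defEquivA_symm_tmul, tripleEquivA_tmul A _ _ _ _ _ (defEquivA_tmul A _ _ _ _)]
    | add w₁ w₂ h₁ h₂ => simp only [tmul_add, map_add, h₁, h₂]
  ext x y z
  simp [lT2, ext22A, defEquivA_tmul, key,
    tripleEquivA_tmul A _ _ _ _ _ (defEquivA_tmul A _ _ _ _)]

end BaseChange

section Series

variable {A : Type*} [CommRing A] [Algebra k A]
variable {M N P : Type*} [AddCommGroup M] [Module k M] [AddCommGroup N] [Module k N]
  [AddCommGroup P] [Module k P]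

/-- The truncated series `Σ_{i ≤ m} εⁱ Fᵢ`, extended `A`-linearly. -/
def truncSeries (ε : A) (m : ℕ) (F : ℕ → M →ₗ[k] N) : A ⊗[k] M →ₗ[A] A ⊗[k] N :=
  ∑ i ∈ Finset.range (m + 1), ε ^ i • (F i).baseChange A

/-- The coefficients of the composite of two series of linear maps. -/
def convComp (F : ℕ → N →ₗ[k] P) (G : ℕ → M →ₗ[k] N) (r : ℕ) : M →ₗ[k] P :=
  ∑ p ∈ antidiagonal r, F p.1 ∘ₗ G p.2

theorem truncSeries_comp (ε : A) (m : ℕ) (hε : ε ^ (m + 1) = 0)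
    (F : ℕ → N →ₗ[k] P) (G : ℕ → M →ₗ[k] N) :
    truncSeries ε m F ∘ₗ truncSeries ε m G = truncSeries ε m (convComp F G) := by
  have hz : ∀ i j : ℕ, m < i + j → ε ^ (i + j) = 0 := fun i j h => pow_eq_zero_of_le h hε
  have hL : truncSeries ε m F ∘ₗ truncSeries ε m G =
      ∑ p ∈ Finset.range (m + 1) ×ˢ Finset.range (m + 1),
        ε ^ (p.1 + p.2) • (F p.1 ∘ₗ G p.2).baseChange A := by
    rw [Finset.sum_product]
    simp only [truncSeries, linearMap_sum_comp]
    simp only [linearMap_comp_sum, LinearMap.smul_comp, LinearMap.comp_smul, smul_smul, ← pow_add,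
      LinearMap.baseChange_comp, add_comm]
  have hR : truncSeries ε m (convComp F G) =
      ∑ q ∈ (Finset.range (m + 1)).sigma antidiagonal,
        ε ^ (q.2.1 + q.2.2) • (F q.2.1 ∘ₗ G q.2.2).baseChange A := by
    rw [Finset.sum_sigma]
    refine Finset.sum_congr rfl fun r _ => ?_
    have h : (convComp F G r).baseChange A =
        ∑ p ∈ antidiagonal r, (F p.1 ∘ₗ G p.2).baseChange A :=
      map_sum (LinearMap.baseChangeHom k A M P) _ _
    rw [h, Finset.smul_sum]
    refine Finset.sum_congr rfl fun p hp => ?_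
    rw [mem_antidiagonal.1 hp]
  rw [hL, hR]
  symm
  refine Finset.sum_of_injOn (fun q => q.2) ?_ ?_ ?_ ?_
  · rintro ⟨r, p⟩ h ⟨s, q⟩ h' (rfl : p = q)
    simp only [Finset.coe_sigma, Set.mem_sigma_iff, Finset.mem_coe, mem_antidiagonal] at h h'
    obtain rfl : r = s := h.2.symm.trans h'.2
    rfl
  · rintro ⟨r, p⟩ h
    simp only [Finset.coe_sigma, Set.mem_sigma_iff, Finset.mem_coe, mem_antidiagonal,
      Finset.mem_range] at h
    simp only [Finset.mem_coe, Finset.mem_product, Finset.mem_range]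
    omega
  · rintro ⟨i, j⟩ _ h
    rw [hz, zero_smul]
    by_contra hlt
    refine h ⟨⟨i + j, (i, j)⟩, ?_, rfl⟩
    simp only [Finset.coe_sigma, Set.mem_sigma_iff, Finset.mem_coe, mem_antidiagonal,
      Finset.mem_range, and_true]
    omega
  · intros
    rfl

theorem hbar_pow_succ (m : ℕ) : hbar k m ^ (m + 1) = 0 := by
  rw [hbar, ← map_pow]
  exact Ideal.Quotient.eq_zero_iff_mem.2 (Ideal.subset_span rfl)

theorem exists_coeff_hbar_pow (m j : ℕ) (hj : j ≤ m) :
    ∃ c : TruncPoly k m →ₗ[k] k, ∀ i, c (hbar k m ^ i) = if i = j then 1 else 0 := by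
  let I : Ideal (Polynomial k) := Ideal.span {(Polynomial.X : Polynomial k) ^ (m + 1)}
  have hI : I.restrictScalars k ≤ LinearMap.ker (Polynomial.lcoeff k j) := by
    intro p hp
    have hp : p ∈ I := hp
    rw [Ideal.mem_span_singleton, Polynomial.X_pow_dvd_iff] at hp
    exact hp j (by omega)
  refine ⟨(I.restrictScalars k).liftQ (Polynomial.lcoeff k j) hI ∘ₗ
    (Submodule.Quotient.restrictScalarsEquiv k I).symm.toLinearMap, fun i => ?_⟩
  rw [hbar, ← map_pow]
  have h : (Polynomial.lcoeff k j) (Polynomial.X ^ i) = if i = j then 1 else 0 := by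
    simp [Polynomial.coeff_X_pow, eq_comm]
  exact h

theorem truncSeries_hbar_inj (m : ℕ) (F G : ℕ → M →ₗ[k] N) :
    truncSeries (hbar k m) m F = truncSeries (hbar k m) m G ↔ ∀ r ≤ m, F r = G r := by
  constructor
  · intro h r hr
    obtain ⟨c, hc⟩ := exists_coeff_hbar_pow (k := k) m r hr
    have hcoeff : ∀ (H : ℕ → M →ₗ[k] N) (x : M),
        TensorProduct.lid k N (c.rTensor N (truncSeries (hbar k m) m H (1 ⊗ₜ[k] x))) = H r x := by
      intro H x
      simp [truncSeries, LinearMap.sum_apply, TensorProduct.smul_tmul', hc, Nat.lt_succ_of_le hr]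
    ext x
    rw [← hcoeff F x, ← hcoeff G x, h]
  · intro h
    refine Finset.sum_congr rfl fun r hr => ?_
    rw [h r (Nat.lt_succ_iff.1 (Finset.mem_range.1 hr))]

end Series

section Conjugation

variable {A : Type*} [CommSemiring A] {M M' N N' P P' : Type*}
  [AddCommMonoid M] [AddCommMonoid M'] [AddCommMonoid N] [AddCommMonoid N'] [AddCommMonoid P]
  [AddCommMonoid P'] [Module A M] [Module A M'] [Module A N] [Module A N'] [Module A P]
  [Module A P']

theorem conj_comp_conj (eM : M ≃ₗ[A] M') (eN : N ≃ₗ[A] N') (eP : P ≃ₗ[A] P')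
    (f : N' →ₗ[A] P') (g : M' →ₗ[A] N') :
    (eP.symm.toLinearMap ∘ₗ f ∘ₗ eN.toLinearMap) ∘ₗ
        (eN.symm.toLinearMap ∘ₗ g ∘ₗ eM.toLinearMap) =
      eP.symm.toLinearMap ∘ₗ (f ∘ₗ g) ∘ₗ eM.toLinearMap := by
  ext x
  simp

theorem comp_conj (eM : M ≃ₗ[A] M') (eN : N ≃ₗ[A] N') (f : N' →ₗ[A] P) (g : M' →ₗ[A] N') :
    (f ∘ₗ eN.toLinearMap) ∘ₗ (eN.symm.toLinearMap ∘ₗ g ∘ₗ eM.toLinearMap) =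
      (f ∘ₗ g) ∘ₗ eM.toLinearMap := by
  ext x
  simp

theorem conj_inj (eM : M ≃ₗ[A] M') (eN : N ≃ₗ[A] N') (f g : M' →ₗ[A] N') :
    eN.symm.toLinearMap ∘ₗ f ∘ₗ eM.toLinearMap = eN.symm.toLinearMap ∘ₗ g ∘ₗ eM.toLinearMap ↔
      f = g := by
  refine ⟨fun h => LinearMap.ext fun x => ?_, fun h => h ▸ rfl⟩
  simpa using LinearMap.congr_fun h (eM.symm x)

theorem comp_equiv_inj (eM : M ≃ₗ[A] M') (f g : M' →ₗ[A] N) :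
    f ∘ₗ eM.toLinearMap = g ∘ₗ eM.toLinearMap ↔ f = g := by
  refine ⟨fun h => LinearMap.ext fun x => ?_, fun h => h ▸ rfl⟩
  simpa using LinearMap.congr_fun h (eM.symm x)

end Conjugation

section Deformation

variable {A : Type*} [CommRing A] [Algebra k A] (ε : A) (m : ℕ)
  (ψ : ℕ → V ⊗[k] V →ₗ[k] V) (φ : ℕ → V ⊗[k] V →ₗ[k] V ⊗[k] V)

/-- The multiplication `Σ_{i ≤ m} εⁱ ψᵢ` on `A ⊗ V`. -/
def muSeries : (A ⊗[k] V) ⊗[A] (A ⊗[k] V) →ₗ[A] A ⊗[k] V :=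
  ∑ i ∈ Finset.range (m + 1), ε ^ i • ext21A A (ψ i)

/-- The braiding `Σ_{i ≤ m} εⁱ φᵢ` on `A ⊗ V`. -/
def RSeries : (A ⊗[k] V) ⊗[A] (A ⊗[k] V) →ₗ[A] (A ⊗[k] V) ⊗[A] (A ⊗[k] V) :=
  ∑ i ∈ Finset.range (m + 1), ε ^ i • ext22A A (φ i)

theorem muSeries_eq :
    muSeries ε m ψ = truncSeries (ε) m ψ ∘ₗ (defEquivA A).toLinearMap := by
  simp only [muSeries, truncSeries, ext21A, linearMap_sum_comp, LinearMap.smul_comp]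

theorem RSeries_eq :
    RSeries ε m φ = (defEquivA A).symm.toLinearMap ∘ₗ truncSeries (ε) m φ ∘ₗ
      (defEquivA A).toLinearMap := by
  simp only [RSeries, truncSeries, ext22A, linearMap_sum_comp, LinearMap.smul_comp,
    linearMap_comp_sum, LinearMap.comp_smul]

theorem rT21_muSeries :
    rT21 (muSeries ε m ψ) = (defEquivA A).symm.toLinearMap ∘ₗ
      truncSeries (ε) m (fun i => rT21 (ψ i)) ∘ₗ
        (tripleEquivA A).toLinearMap := by
  rw [LinearEquiv.eq_toLinearMap_symm_comp]
  have h : rT21 (muSeries ε m ψ) = ∑ i ∈ Finset.range (m + 1),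
      ε ^ i • rT21 (ext21A A (ψ i)) := by
    simp only [muSeries, rT21, ← LinearMap.coe_rTensorHom, map_sum, map_smul]
  simp only [h, truncSeries, linearMap_sum_comp, LinearMap.smul_comp,
    linearMap_comp_sum, LinearMap.comp_smul, defEquivA_comp_rT21]

theorem lT21_muSeries :
    lT21 (muSeries ε m ψ) = (defEquivA A).symm.toLinearMap ∘ₗ
      truncSeries (ε) m (fun i => lT21 (ψ i)) ∘ₗ
        (tripleEquivA A).toLinearMap := by
  rw [LinearEquiv.eq_toLinearMap_symm_comp]
  have h : lT21 (muSeries ε m ψ) = ∑ i ∈ Finset.range (m + 1),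
      ε ^ i • lT21 (ext21A A (ψ i)) := by
    simp only [muSeries, lT21, ← LinearMap.coe_lTensorHom, map_sum, map_smul,
      linearMap_sum_comp, LinearMap.smul_comp]
  simp only [h, truncSeries, linearMap_sum_comp, LinearMap.smul_comp,
    linearMap_comp_sum, LinearMap.comp_smul, defEquivA_comp_lT21]

theorem rT2_RSeries :
    rT2 (RSeries ε m φ) = (tripleEquivA A).symm.toLinearMap ∘ₗ
      truncSeries (ε) m (fun i => rT2 (φ i)) ∘ₗ
        (tripleEquivA A).toLinearMap := by
  rw [LinearEquiv.eq_toLinearMap_symm_comp]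
  have h : rT2 (RSeries ε m φ) = ∑ i ∈ Finset.range (m + 1),
      ε ^ i • rT2 (ext22A A (φ i)) := by
    simp only [RSeries, rT2, ← LinearMap.coe_rTensorHom, map_sum, map_smul]
  simp only [h, truncSeries, linearMap_sum_comp, LinearMap.smul_comp,
    linearMap_comp_sum, LinearMap.comp_smul, tripleEquivA_comp_rT2]

theorem lT2_RSeries :
    lT2 (RSeries ε m φ) = (tripleEquivA A).symm.toLinearMap ∘ₗ
      truncSeries (ε) m (fun i => lT2 (φ i)) ∘ₗ
        (tripleEquivA A).toLinearMap := by
  rw [LinearEquiv.eq_toLinearMap_symm_comp]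
  have h : lT2 (RSeries ε m φ) = ∑ i ∈ Finset.range (m + 1),
      ε ^ i • lT2 (ext22A A (φ i)) := by
    simp only [RSeries, lT2, ← LinearMap.coe_lTensorHom, map_sum, map_smul,
      linearMap_sum_comp, LinearMap.smul_comp, linearMap_comp_sum, LinearMap.comp_smul]
  simp only [h, truncSeries, linearMap_sum_comp, LinearMap.smul_comp,
    linearMap_comp_sum, LinearMap.comp_smul, tripleEquivA_comp_lT2]

theorem muSeries_RSeries_equations_iff {A : Type*} [CommRing A] [Algebra k A] (ε : A) (m : ℕ)
    (hε : ε ^ (m + 1) = 0) (ψ : ℕ → V ⊗[k] V →ₗ[k] V) (φ : ℕ → V ⊗[k] V →ₗ[k] V ⊗[k] V) :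
    (muSeries ε m ψ ∘ₗ rT21 (muSeries ε m ψ) = muSeries ε m ψ ∘ₗ lT21 (muSeries ε m ψ) ∧
      rT2 (RSeries ε m φ) ∘ₗ lT2 (RSeries ε m φ) ∘ₗ rT2 (RSeries ε m φ) =
        lT2 (RSeries ε m φ) ∘ₗ rT2 (RSeries ε m φ) ∘ₗ lT2 (RSeries ε m φ) ∧
      lT21 (muSeries ε m ψ) ∘ₗ rT2 (RSeries ε m φ) ∘ₗ lT2 (RSeries ε m φ) =
        RSeries ε m φ ∘ₗ rT21 (muSeries ε m ψ) ∧
      rT21 (muSeries ε m ψ) ∘ₗ lT2 (RSeries ε m φ) ∘ₗ rT2 (RSeries ε m φ) =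
        RSeries ε m φ ∘ₗ lT21 (muSeries ε m ψ) ∧
      muSeries ε m ψ ∘ₗ RSeries ε m φ = muSeries ε m ψ) ↔
    (truncSeries ε m (convComp ψ (fun i => rT21 (ψ i))) =
        truncSeries ε m (convComp ψ (fun i => lT21 (ψ i))) ∧
      truncSeries ε m
          (convComp (fun i => rT2 (φ i)) (convComp (fun i => lT2 (φ i)) fun i => rT2 (φ i))) =
        truncSeries ε m
          (convComp (fun i => lT2 (φ i)) (convComp (fun i => rT2 (φ i)) fun i => lT2 (φ i))) ∧
      truncSeries ε m
          (convComp (fun i => lT21 (ψ i)) (convComp (fun i => rT2 (φ i)) fun i => lT2 (φ i))) =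
        truncSeries ε m (convComp φ (fun i => rT21 (ψ i))) ∧
      truncSeries ε m
          (convComp (fun i => rT21 (ψ i)) (convComp (fun i => lT2 (φ i)) fun i => rT2 (φ i))) =
        truncSeries ε m (convComp φ (fun i => lT21 (ψ i))) ∧
      truncSeries ε m (convComp ψ φ) = truncSeries ε m ψ) := by
  simp only [rT2_RSeries, lT2_RSeries, rT21_muSeries, lT21_muSeries]
  simp only [muSeries_eq, RSeries_eq, conj_comp_conj, comp_conj, conj_inj, comp_equiv_inj,
    truncSeries_comp ε m hε]

end Deformation

/-- The degree-`r` coefficients of the five equations defining a braided commutative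
deformation. -/
def BCEquationsAt (ψ : ℕ → V ⊗[k] V →ₗ[k] V) (φ : ℕ → V ⊗[k] V →ₗ[k] V ⊗[k] V)
    (r : ℕ) : Prop :=
  convComp ψ (fun i => rT21 (ψ i)) r = convComp ψ (fun i => lT21 (ψ i)) r ∧
  convComp (fun i => rT2 (φ i)) (convComp (fun i => lT2 (φ i)) fun i => rT2 (φ i)) r =
    convComp (fun i => lT2 (φ i)) (convComp (fun i => rT2 (φ i)) fun i => lT2 (φ i)) r ∧
  convComp (fun i => lT21 (ψ i)) (convComp (fun i => rT2 (φ i)) fun i => lT2 (φ i)) r =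
    convComp φ (fun i => rT21 (ψ i)) r ∧
  convComp (fun i => rT21 (ψ i)) (convComp (fun i => lT2 (φ i)) fun i => rT2 (φ i)) r =
    convComp φ (fun i => lT21 (ψ i)) r ∧
  convComp ψ φ r = ψ r

theorem isBCDeformation_iff (ψ : ℕ → V ⊗[k] V →ₗ[k] V)
    (φ : ℕ → V ⊗[k] V →ₗ[k] V ⊗[k] V) (m : ℕ) :
    IsBCDeformation ψ φ m ↔ ∀ r ≤ m, BCEquationsAt ψ φ r := by
  refine (muSeries_RSeries_equations_iff (hbar k m) m (hbar_pow_succ m) ψ φ).trans ?_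
  simp only [truncSeries_hbar_inj, BCEquationsAt, forall_and]

section Coefficients

variable {X : Type*} [AddCommGroup X]

theorem sum_antidiagonal_eq_add_sum_Gam2 (f : ℕ → ℕ → X) (n : ℕ) :
    ∑ p ∈ antidiagonal (n + 1), f p.1 p.2 =
      f 0 (n + 1) + f (n + 1) 0 + ∑ p ∈ Gam2 (n + 1), f p.1 p.2 := by
  have h : antidiagonal (n + 1) =
      insert (0, n + 1) (insert (n + 1, 0) (Gam2 (n + 1))) := by
    ext ⟨i, j⟩
    simp only [Gam2, mem_antidiagonal, Finset.mem_insert, Finset.mem_filter,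
      Finset.mem_product, Finset.mem_range, Prod.mk.injEq]
    omega
  rw [h, Finset.sum_insert, Finset.sum_insert, add_assoc]
  · simp [Gam2]
  · simp [Gam2]

theorem sum_antidiagonal_eq_add_sum_Gam (f : ℕ → ℕ → ℕ → X) (n : ℕ) :
    ∑ p ∈ antidiagonal (n + 1), ∑ q ∈ antidiagonal p.2, f p.1 q.1 q.2 =
      f 0 0 (n + 1) + f 0 (n + 1) 0 + f (n + 1) 0 0 +
        ∑ p ∈ Gam (n + 1), f p.1 p.2.1 p.2.2 := by
  have h : ∑ p ∈ antidiagonal (n + 1), ∑ q ∈ antidiagonal p.2, f p.1 q.1 q.2 =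
      ∑ t ∈ insert (0, 0, n + 1) (insert (0, n + 1, 0) (insert (n + 1, 0, 0) (Gam (n + 1)))),
        f t.1 t.2.1 t.2.2 := by
    rw [Finset.sum_sigma']
    refine Finset.sum_nbij' (fun s => (s.1.1, s.2)) (fun t => ⟨(t.1, t.2.1 + t.2.2), t.2⟩)
      ?_ ?_ ?_ ?_ ?_
    · rintro ⟨⟨i, l⟩, ⟨j, k⟩⟩
      simp only [Gam, Finset.mem_sigma, mem_antidiagonal, Finset.mem_insert,
        Finset.mem_filter, Finset.mem_product, Finset.mem_range, Prod.mk.injEq]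
      omega
    · rintro ⟨i, j, k⟩
      simp only [Gam, Finset.mem_sigma, mem_antidiagonal, Finset.mem_insert,
        Finset.mem_filter, Finset.mem_product, Finset.mem_range, Prod.mk.injEq, and_true]
      omega
    · rintro ⟨⟨i, l⟩, ⟨j, k⟩⟩ hs
      obtain rfl : j + k = l := (mem_antidiagonal.1 (Finset.mem_sigma.1 hs).2)
      rfl
    · intros
      rfl
    · intros
      rfl
  rw [h, Finset.sum_insert, Finset.sum_insert, Finset.sum_insert]
  · simp only [add_assoc]
  · simp [Gam]
  · simp [Gam]
  · simp [Gam]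

variable {M N P Q : Type*} [AddCommGroup M] [Module k M] [AddCommGroup N] [Module k N]
  [AddCommGroup P] [Module k P] [AddCommGroup Q] [Module k Q]

theorem convComp_succ (F : ℕ → N →ₗ[k] P) (G : ℕ → M →ₗ[k] N) (n : ℕ) :
    convComp F G (n + 1) = F 0 ∘ₗ G (n + 1) + F (n + 1) ∘ₗ G 0 +
      ∑ p ∈ Gam2 (n + 1), F p.1 ∘ₗ G p.2 :=
  sum_antidiagonal_eq_add_sum_Gam2 (fun i j => F i ∘ₗ G j) n

theorem convComp_convComp_succ (F : ℕ → P →ₗ[k] Q) (G : ℕ → N →ₗ[k] P) (H : ℕ → M →ₗ[k] N)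
    (n : ℕ) :
    convComp F (convComp G H) (n + 1) = F 0 ∘ₗ G 0 ∘ₗ H (n + 1) + F 0 ∘ₗ G (n + 1) ∘ₗ H 0 +
      F (n + 1) ∘ₗ G 0 ∘ₗ H 0 + ∑ p ∈ Gam (n + 1), F p.1 ∘ₗ G p.2.1 ∘ₗ H p.2.2 := by
  rw [← sum_antidiagonal_eq_add_sum_Gam (fun i j l => F i ∘ₗ G j ∘ₗ H l)]
  simp only [convComp, linearMap_comp_sum]

end Coefficients

theorem eq_iff_eq_zero_of_sub_eq {X : Type*} [AddGroup X] {a b c : X} (h : a - b = c) :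
    a = b ↔ c = 0 := by
  rw [← h, sub_eq_zero]

theorem BCEquationsAt_succ_iff (ψ : ℕ → V ⊗[k] V →ₗ[k] V)
    (φ : ℕ → V ⊗[k] V →ₗ[k] V ⊗[k] V) (n : ℕ) :
    BCEquationsAt ψ φ (n + 1) ↔
      (d2YB (φ 0) (φ (n+1)) + Theta φ (n+1) = 0 ∧
       d2IY (ψ 0) (φ 0) (φ (n+1)) (ψ (n+1)) + XiIY ψ φ (n+1) - OmIY ψ φ (n+1) = 0 ∧
       d2YI (ψ 0) (φ 0) (φ (n+1)) (ψ (n+1)) + XiYI ψ φ (n+1) - OmYI ψ φ (n+1) = 0 ∧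
       d2H (ψ 0) (ψ (n+1)) + Lam ψ (n+1) = 0 ∧
       ψ 0 ∘ₗ φ (n+1) + ψ (n+1) ∘ₗ φ 0 - ψ (n+1) + Ups ψ φ (n+1) = 0) := by
  have hH : convComp ψ (fun i => rT21 (ψ i)) (n + 1) - convComp ψ (fun i => lT21 (ψ i)) (n + 1) =
      d2H (ψ 0) (ψ (n+1)) + Lam ψ (n+1) := by
    simp only [convComp_succ, d2H, Lam, Finset.sum_sub_distrib]
    abel
  have hYB : convComp (fun i => rT2 (φ i)) (convComp (fun i => lT2 (φ i)) fun i => rT2 (φ i))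
        (n + 1) -
      convComp (fun i => lT2 (φ i)) (convComp (fun i => rT2 (φ i)) fun i => lT2 (φ i)) (n + 1) =
      d2YB (φ 0) (φ (n+1)) + Theta φ (n+1) := by
    have hΘ : Theta φ (n + 1) =
        ∑ p ∈ Gam (n + 1), rT2 (φ p.1) ∘ₗ lT2 (φ p.2.1) ∘ₗ rT2 (φ p.2.2) -
          ∑ p ∈ Gam (n + 1), lT2 (φ p.1) ∘ₗ rT2 (φ p.2.1) ∘ₗ lT2 (φ p.2.2) := by
      refine LinearMap.ext fun x => ?_
      simp only [Theta, LinearMap.sum_apply, LinearMap.sub_apply, Finset.sum_sub_distrib]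
    simp only [convComp_convComp_succ, d2YB, hΘ]
    abel
  have hYI : convComp (fun i => lT21 (ψ i)) (convComp (fun i => rT2 (φ i)) fun i => lT2 (φ i))
        (n + 1) - convComp φ (fun i => rT21 (ψ i)) (n + 1) =
      d2YI (ψ 0) (φ 0) (φ (n+1)) (ψ (n+1)) + XiYI ψ φ (n+1) - OmYI ψ φ (n+1) := by
    rw [convComp_convComp_succ, convComp_succ, d2YI, XiYI, OmYI]
    abel
  have hIY : convComp (fun i => rT21 (ψ i)) (convComp (fun i => lT2 (φ i)) fun i => rT2 (φ i))
        (n + 1) - convComp φ (fun i => lT21 (ψ i)) (n + 1) =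
      d2IY (ψ 0) (φ 0) (φ (n+1)) (ψ (n+1)) + XiIY ψ φ (n+1) - OmIY ψ φ (n+1) := by
    rw [convComp_convComp_succ, convComp_succ, d2IY, XiIY, OmIY]
    abel
  have hBC : convComp ψ φ (n + 1) - ψ (n + 1) =
      ψ 0 ∘ₗ φ (n+1) + ψ (n+1) ∘ₗ φ 0 - ψ (n+1) + Ups ψ φ (n+1) := by
    simp only [convComp_succ, Ups]
    abel
  refine (and_congr (eq_iff_eq_zero_of_sub_eq hH) (and_congr (eq_iff_eq_zero_of_sub_eq hYB)
    (and_congr (eq_iff_eq_zero_of_sub_eq hYI) (and_congr (eq_iff_eq_zero_of_sub_eq hIY)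
      (eq_iff_eq_zero_of_sub_eq hBC))))).trans ?_
  tauto

/-- for a braided commutative braided algebra `(V, μ, R)` and
families `ψᵢ, φᵢ` with `ψ₀ = μ`, `φ₀ = R`, if `(V_n, μ_n, R_n)` is a braided
commutative deformation of degree `n`, then `(V_{n+1}, μ_{n+1}, R_{n+1})` is a
braided commutative deformation of degree `n+1` if and only if the five
deformation equations of Lemma 6.7 hold. -/
theorem BC_deformation_extends_iff {k : Type*} [CommRing k] {V : Type*}
    [AddCommGroup V] [Module k V]
    (μ : V ⊗[k] V →ₗ[k] V) (R : V ⊗[k] V →ₗ[k] V ⊗[k] V)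
    (hBA : IsBraidedAlgebra μ R) (hBC : μ ∘ₗ R = μ) (n : ℕ)
    (ψ : ℕ → V ⊗[k] V →ₗ[k] V) (φ : ℕ → V ⊗[k] V →ₗ[k] V ⊗[k] V)
    (hψ0 : ψ 0 = μ) (hφ0 : φ 0 = R)
    (hdefn : IsBCDeformation ψ φ n) :
    IsBCDeformation ψ φ (n + 1) ↔
      (d2YB R (φ (n+1)) + Theta φ (n+1) = 0 ∧
       d2IY μ R (φ (n+1)) (ψ (n+1)) + XiIY ψ φ (n+1) - OmIY ψ φ (n+1) = 0 ∧
       d2YI μ R (φ (n+1)) (ψ (n+1)) + XiYI ψ φ (n+1) - OmYI ψ φ (n+1) = 0 ∧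
       d2H μ (ψ (n+1)) + Lam ψ (n+1) = 0 ∧
       μ ∘ₗ φ (n+1) + ψ (n+1) ∘ₗ R - ψ (n+1) + Ups ψ φ (n+1) = 0) := by
  subst hψ0 hφ0
  rw [isBCDeformation_iff] at hdefn
  rw [← BCEquationsAt_succ_iff, isBCDeformation_iff]
  refine ⟨fun h => h _ le_rfl, fun h r hr => ?_⟩
  rcases Nat.le_succ_iff.1 hr with hr | rfl
  · exact hdefn r hr
  · exact h

end
end

section
/- Let (V, μ, R) be a braided commutative braided algebra over a commutative ring k and let ψᵢ : V⊗V → V, φᵢ : V⊗V → V⊗V (1 ≤ i ≤ n+1) with ψ₀ = μ, φ₀ = R form a braided commutative deformation of degree n, i.e., for every 1 ≤ r ≤ n: δ²_YB(φ_r) + Θ_r = 0, δ²_IY(φ_r,ψ_r) + Ξ^{IY}_r − Ω^{IY}_r = 0, δ²_YI(φ_r,ψ_r) + Ξ^{YI}_r − Ω^{YI}_r = 0, δ²_H(ψ_r) + Λ_r = 0, and μφ_r + ψ_rR − ψ_r + Υ_r = 0 (with Θ₁ = Ξ₁ = Ω₁ = Λ₁ = Υ₁ = 0). Then the braided-commutativity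 components of the third differential annihilate the degree-(n+1) obstruction: δ³_BC:YI(Ξ^{YI}_{n+1} − Ω^{YI}_{n+1}, Θ_{n+1}, Υ_{n+1}) = 0 and δ³_BC:IY(Ξ^{IY}_{n+1} − Ω^{IY}_{n+1}, Θ_{n+1}, Υ_{n+1}) = 0. -/
open TensorProduct LinearMap

noncomputable section

variable {k : Type*} [CommRing k] {V : Type*} [AddCommGroup V] [Module k V]

section Convolution

variable {M N P Q : Type*} [AddCommGroup M] [Module k M] [AddCommGroup N] [Module k N]
  [AddCommGroup P] [Module k P] [AddCommGroup Q] [Module k Q]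

/-- Coefficients of the composition of two formal power series of linear maps. -/
def conv (f : ℕ → N →ₗ[k] P) (g : ℕ → M →ₗ[k] N) (r : ℕ) : M →ₗ[k] P :=
  ∑ p ∈ Finset.HasAntidiagonal.antidiagonal r, f p.1 ∘ₗ g p.2

lemma conv_assoc (f : ℕ → P →ₗ[k] Q) (g : ℕ → N →ₗ[k] P) (h : ℕ → M →ₗ[k] N) :
    conv (conv f g) h = conv f (conv g h) := by
  funext r
  ext x
  simp only [conv, LinearMap.sum_apply, LinearMap.comp_apply, map_sum, Finset.sum_sigma']
  refine Finset.sum_nbij' (fun y ↦ ⟨(y.2.1, y.2.2 + y.1.2), (y.2.2, y.1.2)⟩)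
    (fun y ↦ ⟨(y.1.1 + y.2.1, y.2.2), (y.1.1, y.2.1)⟩) ?_ ?_ ?_ ?_ ?_ <;>
    simp +contextual [Sigma.forall, ← add_assoc]
  lia

lemma conv_sub (f : ℕ → N →ₗ[k] P) (g h : ℕ → M →ₗ[k] N) :
    conv f (g - h) = conv f g - conv f h := by
  funext r
  simp [conv, LinearMap.comp_sub]

lemma sub_conv (f g : ℕ → N →ₗ[k] P) (h : ℕ → M →ₗ[k] N) :
    conv (f - g) h = conv f h - conv g h := by
  funext r
  simp [conv, LinearMap.sub_comp]

lemma conv_zero_apply (f : ℕ → N →ₗ[k] P) (g : ℕ → M →ₗ[k] N) :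
    conv f g 0 = f 0 ∘ₗ g 0 := by
  simp [conv]

lemma conv_of_right_eq_zero (f : ℕ → N →ₗ[k] P) {g : ℕ → M →ₗ[k] N} {r : ℕ}
    (hg : ∀ i < r, g i = 0) : conv f g r = f 0 ∘ₗ g r := by
  refine Finset.sum_eq_single (0, r) (fun p hp hne ↦ ?_) (by simp)
  rw [Finset.HasAntidiagonal.mem_antidiagonal] at hp
  have : p.2 < r := by
    by_contra h
    exact hne (Prod.ext (by simp; lia) (by simp; lia))
  rw [hg _ this, LinearMap.comp_zero]

lemma conv_of_left_eq_zero {f : ℕ → N →ₗ[k] P} (g : ℕ → M →ₗ[k] N) {r : ℕ}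
    (hf : ∀ i < r, f i = 0) : conv f g r = f r ∘ₗ g 0 := by
  refine Finset.sum_eq_single (r, 0) (fun p hp hne ↦ ?_) (by simp)
  rw [Finset.HasAntidiagonal.mem_antidiagonal] at hp
  have : p.1 < r := by
    by_contra h
    exact hne (Prod.ext (by simp; lia) (by simp; lia))
  rw [hf _ this, LinearMap.zero_comp]

/-- The leading coefficients of the defects of the relations `q a b = φ p`, `a b a = b a b`,
`p a = p` and `q b = q` between formal power series satisfy a linear relation. -/
lemma leading_defect_relation (a b : ℕ → M →ₗ[k] M) (p q : ℕ → M →ₗ[k] N)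
    (φ : ℕ → N →ₗ[k] N) (r : ℕ)
    (hA : ∀ i < r, (conv q (conv a b) - conv φ p) i = 0)
    (hB : ∀ i < r, (conv a (conv b a) - conv b (conv a b)) i = 0)
    (hp : ∀ i < r, (conv p a - p) i = 0) (hq : ∀ i < r, (conv q b - q) i = 0) :
    (conv q (conv a b) - conv φ p) r ∘ₗ a 0 + φ 0 ∘ₗ (conv p a - p) r
      - q 0 ∘ₗ (conv a (conv b a) - conv b (conv a b)) r
      - (conv q b - q) r ∘ₗ a 0 ∘ₗ b 0 - (conv q (conv a b) - conv φ p) r = 0 := by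
  rw [← conv_zero_apply a b, ← conv_of_left_eq_zero a hA, ← conv_of_right_eq_zero φ hp,
    ← conv_of_right_eq_zero q hB, ← conv_of_left_eq_zero (conv a b) hq]
  simp only [conv_sub, sub_conv, conv_assoc, Pi.sub_apply]
  abel

end Convolution

section IndexSets

variable {A : Type*} [AddCommGroup A]

lemma sum_antidiagonal_eq_sum_Gam2 (F : ℕ → ℕ → A) {r : ℕ} (hr : r ≠ 0) :
    ∑ p ∈ Finset.HasAntidiagonal.antidiagonal r, F p.1 p.2 =
      ∑ p ∈ Gam2 r, F p.1 p.2 + F r 0 + F 0 r := by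
  have h : Finset.HasAntidiagonal.antidiagonal r = insert (r, 0) (insert (0, r) (Gam2 r)) := by
    ext ⟨i, j⟩
    simp only [Gam2, Finset.HasAntidiagonal.mem_antidiagonal, Finset.mem_insert, Finset.mem_filter,
      Finset.mem_product, Finset.mem_range, Prod.mk.injEq]
    lia
  rw [h, Finset.sum_insert (by simp [Gam2, hr]), Finset.sum_insert (by simp [Gam2])]
  abel

lemma sum_antidiagonal_eq_sum_Gam (F : ℕ → ℕ → ℕ → A) {r : ℕ} (hr : r ≠ 0) :
    ∑ p ∈ Finset.HasAntidiagonal.antidiagonal r,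
      ∑ q ∈ Finset.HasAntidiagonal.antidiagonal p.2, F p.1 q.1 q.2 =
      ∑ p ∈ Gam r, F p.1 p.2.1 p.2.2 + F r 0 0 + F 0 r 0 + F 0 0 r := by
  have h : ∑ p ∈ Finset.HasAntidiagonal.antidiagonal r,
      ∑ q ∈ Finset.HasAntidiagonal.antidiagonal p.2, F p.1 q.1 q.2 =
      ∑ p ∈ insert (r, 0, 0) (insert (0, r, 0) (insert (0, 0, r) (Gam r))),
        F p.1 p.2.1 p.2.2 := by
    rw [Finset.sum_sigma']
    refine Finset.sum_nbij' (fun x ↦ (x.1.1, x.2.1, x.2.2))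
      (fun y ↦ ⟨(y.1, y.2.1 + y.2.2), (y.2.1, y.2.2)⟩) ?_ ?_ ?_ ?_ ?_
    · rintro ⟨⟨i, s⟩, j, l⟩ hx
      simp only [Gam, Finset.mem_sigma, Finset.HasAntidiagonal.mem_antidiagonal, Finset.mem_insert,
        Finset.mem_filter, Finset.mem_product, Finset.mem_range, Prod.mk.injEq] at hx ⊢
      lia
    · rintro ⟨i, j, l⟩ hy
      simp only [Gam, Finset.mem_sigma, Finset.HasAntidiagonal.mem_antidiagonal, Finset.mem_insert,
        Finset.mem_filter, Finset.mem_product, Finset.mem_range, Prod.mk.injEq] at hy ⊢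
      lia
    · rintro ⟨⟨i, s⟩, j, l⟩ hx
      obtain ⟨-, rfl⟩ : i + s = r ∧ j + l = s := by simpa using hx
      rfl
    · simp
    · simp
  rw [h, Finset.sum_insert (by simp [Gam, hr]), Finset.sum_insert (by simp [Gam, hr]),
    Finset.sum_insert (by simp [Gam])]
  abel

lemma lt_of_mem_Gam2 {r : ℕ} {p : ℕ × ℕ} (hp : p ∈ Gam2 r) : p.1 < r ∧ p.2 < r := by
  simp only [Gam2, Finset.mem_filter, Finset.mem_product, Finset.mem_range] at hp
  lia

lemma lt_of_mem_Gam {r : ℕ} {p : ℕ × ℕ × ℕ} (hp : p ∈ Gam r) :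
    p.1 < r ∧ p.2.1 < r ∧ p.2.2 < r := by
  simp only [Gam, Finset.mem_filter, Finset.mem_product, Finset.mem_range] at hp
  lia

end IndexSets

section ConvGam

variable {M N P Q : Type*} [AddCommGroup M] [Module k M] [AddCommGroup N] [Module k N]
  [AddCommGroup P] [Module k P] [AddCommGroup Q] [Module k Q]

lemma conv_eq_sum_Gam2 (f : ℕ → N →ₗ[k] P) (g : ℕ → M →ₗ[k] N) {r : ℕ} (hr : r ≠ 0) :
    conv f g r = ∑ p ∈ Gam2 r, f p.1 ∘ₗ g p.2 + f r ∘ₗ g 0 + f 0 ∘ₗ g r :=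
  sum_antidiagonal_eq_sum_Gam2 (fun i j ↦ f i ∘ₗ g j) hr

lemma conv_conv_eq_sum_Gam (f : ℕ → P →ₗ[k] Q) (g : ℕ → N →ₗ[k] P) (h : ℕ → M →ₗ[k] N)
    {r : ℕ} (hr : r ≠ 0) :
    conv f (conv g h) r = ∑ p ∈ Gam r, f p.1 ∘ₗ g p.2.1 ∘ₗ h p.2.2
      + f r ∘ₗ g 0 ∘ₗ h 0 + f 0 ∘ₗ g r ∘ₗ h 0 + f 0 ∘ₗ g 0 ∘ₗ h r := by
  rw [← sum_antidiagonal_eq_sum_Gam (fun i j l ↦ f i ∘ₗ g j ∘ₗ h l) hr]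
  refine Finset.sum_congr rfl fun p _ ↦ ?_
  ext x
  simp [conv, LinearMap.sum_apply]

end ConvGam

section Defects

set_option maxSynthPendingDepth 3

variable (ψ : ℕ → V ⊗[k] V →ₗ[k] V) (φ : ℕ → V ⊗[k] V →ₗ[k] V ⊗[k] V)

/-- The defect of the Yang-Baxter equation for the series `φ`. -/
def defectYB : ℕ → (V ⊗[k] V) ⊗[k] V →ₗ[k] (V ⊗[k] V) ⊗[k] V :=
  conv (fun i ↦ rT2 (φ i)) (conv (fun i ↦ lT2 (φ i)) (fun i ↦ rT2 (φ i)))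
    - conv (fun i ↦ lT2 (φ i)) (conv (fun i ↦ rT2 (φ i)) (fun i ↦ lT2 (φ i)))

/-- The defect of the YI condition for the series `ψ` and `φ`. -/
def defectYI : ℕ → (V ⊗[k] V) ⊗[k] V →ₗ[k] V ⊗[k] V :=
  conv (fun i ↦ lT21 (ψ i)) (conv (fun i ↦ rT2 (φ i)) (fun i ↦ lT2 (φ i)))
    - conv φ (fun i ↦ rT21 (ψ i))

/-- The defect of the IY condition for the series `ψ` and `φ`. -/
def defectIY : ℕ → (V ⊗[k] V) ⊗[k] V →ₗ[k] V ⊗[k] V :=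
  conv (fun i ↦ rT21 (ψ i)) (conv (fun i ↦ lT2 (φ i)) (fun i ↦ rT2 (φ i)))
    - conv φ (fun i ↦ lT21 (ψ i))

/-- The defect of braided commutativity for the series `ψ` and `φ`. -/
def defectBC : ℕ → V ⊗[k] V →ₗ[k] V :=
  conv ψ φ - ψ

variable {r : ℕ}

lemma defectYB_eq (hr : r ≠ 0) : defectYB φ r = d2YB (φ 0) (φ r) + Theta φ r := by
  simp only [defectYB, Pi.sub_apply, conv_conv_eq_sum_Gam _ _ _ hr, d2YB, Theta,
    Finset.sum_sub_distrib]
  abel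

lemma defectYB_zero : defectYB φ 0 = rT2 (φ 0) ∘ₗ lT2 (φ 0) ∘ₗ rT2 (φ 0)
    - lT2 (φ 0) ∘ₗ rT2 (φ 0) ∘ₗ lT2 (φ 0) := by
  simp only [defectYB, Pi.sub_apply, conv_zero_apply]

lemma d2YB_zero (R : V ⊗[k] V →ₗ[k] V ⊗[k] V) : d2YB R 0 = 0 := by
  simp [d2YB, rT2, lT2]

lemma defectYI_eq (hr : r ≠ 0) :
    defectYI ψ φ r = d2YI (ψ 0) (φ 0) (φ r) (ψ r) + XiYI ψ φ r - OmYI ψ φ r := by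
  simp only [defectYI, Pi.sub_apply, conv_conv_eq_sum_Gam _ _ _ hr, conv_eq_sum_Gam2 _ _ hr,
    d2YI, XiYI, OmYI]
  abel

lemma defectIY_eq (hr : r ≠ 0) :
    defectIY ψ φ r = d2IY (ψ 0) (φ 0) (φ r) (ψ r) + XiIY ψ φ r - OmIY ψ φ r := by
  simp only [defectIY, Pi.sub_apply, conv_conv_eq_sum_Gam _ _ _ hr, conv_eq_sum_Gam2 _ _ hr,
    d2IY, XiIY, OmIY]
  abel

lemma defectBC_eq (hr : r ≠ 0) :
    defectBC ψ φ r = ψ 0 ∘ₗ φ r + ψ r ∘ₗ φ 0 - ψ r + Ups ψ φ r := by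
  simp only [defectBC, Pi.sub_apply, conv_eq_sum_Gam2 _ _ hr, Ups]
  abel

lemma conv_rT21_sub : conv (fun i ↦ rT21 (ψ i)) (fun i ↦ rT2 (φ i)) - (fun i ↦ rT21 (ψ i)) =
    fun i ↦ rT21 (defectBC ψ φ i) := by
  funext i
  ext x y z
  simp [conv, defectBC, rT21, rT2, LinearMap.sum_apply, TensorProduct.sum_tmul]

lemma conv_lT21_sub : conv (fun i ↦ lT21 (ψ i)) (fun i ↦ lT2 (φ i)) - (fun i ↦ lT21 (ψ i)) =
    fun i ↦ lT21 (defectBC ψ φ i) := by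
  funext i
  ext x y z
  simp [conv, defectBC, lT21, lT2, LinearMap.sum_apply, TensorProduct.tmul_sum]

lemma d3BCYI_defect_eq_zero (hYB : ∀ i < r, defectYB φ i = 0)
    (hYI : ∀ i < r, defectYI ψ φ i = 0) (hBC : ∀ i < r, defectBC ψ φ i = 0) :
    d3BCYI (ψ 0) (φ 0) (defectYI ψ φ r) (defectYB φ r) (defectBC ψ φ r) = 0 := by
  have key := leading_defect_relation (fun i ↦ rT2 (φ i)) (fun i ↦ lT2 (φ i))
    (fun i ↦ rT21 (ψ i)) (fun i ↦ lT21 (ψ i)) φ r hYI hYB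
  rw [conv_rT21_sub, conv_lT21_sub] at key
  exact key (fun i hi ↦ by simp [hBC i hi, rT21]) (fun i hi ↦ by simp [hBC i hi, lT21])

lemma d3BCIY_defect_eq_zero (hYB : ∀ i < r, defectYB φ i = 0)
    (hIY : ∀ i < r, defectIY ψ φ i = 0) (hBC : ∀ i < r, defectBC ψ φ i = 0) :
    d3BCIY (ψ 0) (φ 0) (defectIY ψ φ r) (defectYB φ r) (defectBC ψ φ r) = 0 := by
  have key := leading_defect_relation (fun i ↦ lT2 (φ i)) (fun i ↦ rT2 (φ i))
    (fun i ↦ lT21 (ψ i)) (fun i ↦ rT21 (ψ i)) φ r hIY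
    (fun i hi ↦ by
      rw [← neg_sub, Pi.neg_apply]
      exact neg_eq_zero.mpr (hYB i hi))
  rw [conv_rT21_sub, conv_lT21_sub] at key
  have key' := key (fun i hi ↦ by simp [hBC i hi, lT21]) (fun i hi ↦ by simp [hBC i hi, rT21])
  rw [← neg_sub (conv (fun i ↦ rT2 (φ i)) _), ← defectYB, ← defectIY, Pi.neg_apply,
    LinearMap.comp_neg] at key'
  rw [← key', d3BCIY]
  abel

end Defects

section Congruence

variable {ψ ψ' : ℕ → V ⊗[k] V →ₗ[k] V} {φ φ' : ℕ → V ⊗[k] V →ₗ[k] V ⊗[k] V} {r : ℕ}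

lemma Theta_congr (hφ : ∀ i < r, φ i = φ' i) : Theta φ r = Theta φ' r :=
  Finset.sum_congr rfl fun p hp ↦ by
    obtain ⟨h₁, h₂, h₃⟩ := lt_of_mem_Gam hp
    rw [hφ _ h₁, hφ _ h₂, hφ _ h₃]

lemma XiYI_congr (hψ : ∀ i < r, ψ i = ψ' i) (hφ : ∀ i < r, φ i = φ' i) :
    XiYI ψ φ r = XiYI ψ' φ' r :=
  Finset.sum_congr rfl fun p hp ↦ by
    obtain ⟨h₁, h₂, h₃⟩ := lt_of_mem_Gam hp
    rw [hψ _ h₁, hφ _ h₂, hφ _ h₃]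

lemma XiIY_congr (hψ : ∀ i < r, ψ i = ψ' i) (hφ : ∀ i < r, φ i = φ' i) :
    XiIY ψ φ r = XiIY ψ' φ' r :=
  Finset.sum_congr rfl fun p hp ↦ by
    obtain ⟨h₁, h₂, h₃⟩ := lt_of_mem_Gam hp
    rw [hψ _ h₁, hφ _ h₂, hφ _ h₃]

lemma OmYI_congr (hψ : ∀ i < r, ψ i = ψ' i) (hφ : ∀ i < r, φ i = φ' i) :
    OmYI ψ φ r = OmYI ψ' φ' r :=
  Finset.sum_congr rfl fun p hp ↦ by
    obtain ⟨h₁, h₂⟩ := lt_of_mem_Gam2 hp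
    rw [hφ _ h₁, hψ _ h₂]

lemma OmIY_congr (hψ : ∀ i < r, ψ i = ψ' i) (hφ : ∀ i < r, φ i = φ' i) :
    OmIY ψ φ r = OmIY ψ' φ' r :=
  Finset.sum_congr rfl fun p hp ↦ by
    obtain ⟨h₁, h₂⟩ := lt_of_mem_Gam2 hp
    rw [hφ _ h₁, hψ _ h₂]

lemma Ups_congr (hψ : ∀ i < r, ψ i = ψ' i) (hφ : ∀ i < r, φ i = φ' i) :
    Ups ψ φ r = Ups ψ' φ' r :=
  Finset.sum_congr rfl fun p hp ↦ by
    obtain ⟨h₁, h₂⟩ := lt_of_mem_Gam2 hp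
    rw [hψ _ h₁, hφ _ h₂]

end Congruence

/-- if `(ψᵢ, φᵢ)` form a braided commutative deformation of
degree `n` of the braided commutative braided algebra `(V, μ, R)`, then the
braided-commutativity components of the third differential annihilate the
degree-`(n+1)` obstructions. -/
theorem d3BC_annihilates_obstruction {k : Type*} [CommRing k] {V : Type*}
    [AddCommGroup V] [Module k V]
    (μ : V ⊗[k] V →ₗ[k] V) (R : V ⊗[k] V →ₗ[k] V ⊗[k] V)
    (hBA : IsBraidedAlgebra μ R) (hBC : μ ∘ₗ R = μ) (n : ℕ)
    (ψ : ℕ → V ⊗[k] V →ₗ[k] V) (φ : ℕ → V ⊗[k] V →ₗ[k] V ⊗[k] V)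
    (hψ0 : ψ 0 = μ) (hφ0 : φ 0 = R)
    (hdef : ∀ r, 1 ≤ r → r ≤ n →
      d2YB R (φ r) + Theta φ r = 0 ∧
      d2IY μ R (φ r) (ψ r) + XiIY ψ φ r - OmIY ψ φ r = 0 ∧
      d2YI μ R (φ r) (ψ r) + XiYI ψ φ r - OmYI ψ φ r = 0 ∧
      d2H μ (ψ r) + Lam ψ r = 0 ∧
      μ ∘ₗ φ r + ψ r ∘ₗ R - ψ r + Ups ψ φ r = 0) :
    d3BCYI μ R (XiYI ψ φ (n+1) - OmYI ψ φ (n+1)) (Theta φ (n+1)) (Ups ψ φ (n+1)) = 0 ∧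
    d3BCIY μ R (XiIY ψ φ (n+1) - OmIY ψ φ (n+1)) (Theta φ (n+1)) (Ups ψ φ (n+1)) = 0 := by
  -- The obstructions do not involve `ψ (n+1)` and `φ (n+1)`, so these may be replaced by `0`.
  set ψ' := Function.update ψ (n + 1) 0 with hψ'
  set φ' := Function.update φ (n + 1) 0 with hφ'
  have eψ : ∀ i < n + 1, ψ i = ψ' i := fun i hi ↦ by simp [hψ', hi.ne]
  have eφ : ∀ i < n + 1, φ i = φ' i := fun i hi ↦ by simp [hφ', hi.ne]
  have ψ'_zero : ψ' 0 = μ := by rw [← eψ 0 n.succ_pos, hψ0]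
  have φ'_zero : φ' 0 = R := by rw [← eφ 0 n.succ_pos, hφ0]
  have ψ'_last : ψ' (n + 1) = 0 := by simp [hψ']
  have φ'_last : φ' (n + 1) = 0 := by simp [hφ']
  have vanish : ∀ i < n + 1, defectYB φ' i = 0 ∧ defectIY ψ' φ' i = 0 ∧
      defectYI ψ' φ' i = 0 ∧ defectBC ψ' φ' i = 0 := by
    intro i hi
    rcases eq_or_ne i 0 with rfl | h0
    · simp only [defectYB_zero, defectIY, defectYI, defectBC, Pi.sub_apply, conv_zero_apply,
        ψ'_zero, φ'_zero, sub_eq_zero]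
      exact ⟨sub_eq_zero.mpr hBA.yb, hBA.iy, hBA.yi, hBC⟩
    · obtain ⟨hYB, hIY, hYI, -, hBC'⟩ := hdef i (Nat.one_le_iff_ne_zero.mpr h0) (by lia)
      have lψ : ∀ j < i, ψ j = ψ' j := fun j hj ↦ eψ j (hj.trans hi)
      have lφ : ∀ j < i, φ j = φ' j := fun j hj ↦ eφ j (hj.trans hi)
      rw [defectYB_eq φ' h0, defectIY_eq ψ' φ' h0, defectYI_eq ψ' φ' h0, defectBC_eq ψ' φ' h0,
        ψ'_zero, φ'_zero, ← eψ i hi, ← eφ i hi, ← Theta_congr lφ, ← XiIY_congr lψ lφ,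
        ← OmIY_congr lψ lφ, ← XiYI_congr lψ lφ, ← OmYI_congr lψ lφ, ← Ups_congr lψ lφ]
      exact ⟨hYB, hIY, hYI, hBC'⟩
  have hYB : defectYB φ' (n + 1) = Theta φ (n + 1) := by
    rw [defectYB_eq φ' n.succ_ne_zero, φ'_last, Theta_congr eφ, d2YB_zero, zero_add]
  have hIY : defectIY ψ' φ' (n + 1) = XiIY ψ φ (n + 1) - OmIY ψ φ (n + 1) := by
    rw [defectIY_eq ψ' φ' n.succ_ne_zero, φ'_last, ψ'_last, XiIY_congr eψ eφ, OmIY_congr eψ eφ]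
    simp [d2IY, rT2, lT2, rT21, lT21]
  have hYI : defectYI ψ' φ' (n + 1) = XiYI ψ φ (n + 1) - OmYI ψ φ (n + 1) := by
    rw [defectYI_eq ψ' φ' n.succ_ne_zero, φ'_last, ψ'_last, XiYI_congr eψ eφ, OmYI_congr eψ eφ]
    simp [d2YI, rT2, lT2, rT21, lT21]
  have hUps : defectBC ψ' φ' (n + 1) = Ups ψ φ (n + 1) := by
    rw [defectBC_eq ψ' φ' n.succ_ne_zero, φ'_last, ψ'_last, Ups_congr eψ eφ]
    simp
  rw [← hYB, ← hIY, ← hYI, ← hUps, ← ψ'_zero, ← φ'_zero]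
  exact ⟨d3BCYI_defect_eq_zero ψ' φ' (fun i hi ↦ (vanish i hi).1)
      (fun i hi ↦ (vanish i hi).2.2.1) (fun i hi ↦ (vanish i hi).2.2.2),
    d3BCIY_defect_eq_zero ψ' φ' (fun i hi ↦ (vanish i hi).1)
      (fun i hi ↦ (vanish i hi).2.1) (fun i hi ↦ (vanish i hi).2.2.2)⟩

end
end
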